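/- arXiv:math/0307121 — 3 statements merged into one kernel-verified Lean document; each statement's English description precedes it below -/
import Mathlib

section
/- Let G be a finite subgroup of U(2) acting on S = ℂ[X,Y] by (g·f)(v) = f(g⁻¹v), with invariant ring R = S^G. Let x ∈ ℂ², x ≠ 0, let I = {g ∈ G : gx = x} be its stabilizer and e = |I|. Every element of I fixes the line ℂx pointwise, hence I preserves the line L of linear forms vanishing on ℂx and acts on L by a character ε : I → ℂ^× (for the action g·f = f∘g⁻¹). Let 𝔪_x = {f ∈ R : f(x) = 0} and let S𝔪_x be the ideal of S it generates. Then the quotient S/S𝔪_x is finite-dimensional and is isomorphic as a representation of G to the direct sum ⊕_{ν=0}^{e−1} Ind_I^G(ε^ν) of the representations of G induced from the powers of ε (equivalently, to the regular representation of G). -/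
open Matrix MvPolynomial
open scoped Classical

/-- The action of a unitary matrix `g` on polynomial functions on ℂ²:
`(g · f)(v) = f(g⁻¹ v)`. -/
noncomputable def actU2 (g : Matrix.unitaryGroup (Fin 2) ℂ) :
    MvPolynomial (Fin 2) ℂ →ₐ[ℂ] MvPolynomial (Fin 2) ℂ :=
  MvPolynomial.aeval fun i =>
    ∑ j : Fin 2, MvPolynomial.C
      (((g⁻¹ : Matrix.unitaryGroup (Fin 2) ℂ) : Matrix (Fin 2) (Fin 2) ℂ) i j) *
        MvPolynomial.X j

/-- The group of unitary `2 × 2` matrices. -/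
abbrev U2 : Type := Matrix.unitaryGroup (Fin 2) ℂ

/-- The polynomial functions on `ℂ²`. -/
abbrev Poly2 : Type := MvPolynomial (Fin 2) ℂ

/-- The natural action of a unitary matrix on `ℂ²`. -/
def move (g : U2) (v : Fin 2 → ℂ) : Fin 2 → ℂ :=
  (g : Matrix (Fin 2) (Fin 2) ℂ) *ᵥ v

theorem move_one (v : Fin 2 → ℂ) : move 1 v = v := by
  simp [move]

theorem move_mul (g k : U2) (v : Fin 2 → ℂ) : move (g * k) v = move g (move k v) :=
  (Matrix.mulVec_mulVec v _ _).symm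

theorem move_inv_move (g : U2) (v : Fin 2 → ℂ) : move g⁻¹ (move g v) = v := by
  rw [← move_mul, inv_mul_cancel, move_one]

theorem move_move_inv (g : U2) (v : Fin 2 → ℂ) : move g (move g⁻¹ v) = v := by
  rw [← move_mul, mul_inv_cancel, move_one]

theorem move_eq_iff (g : U2) (v w : Fin 2 → ℂ) : move g v = w ↔ v = move g⁻¹ w :=
  ⟨fun h => by rw [← h, move_inv_move], fun h => by rw [h, move_move_inv]⟩

theorem move_add (g : U2) (v w : Fin 2 → ℂ) : move g (v + w) = move g v + move g w :=
  Matrix.mulVec_add _ _ _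

theorem move_smul (g : U2) (c : ℂ) (v : Fin 2 → ℂ) : move g (c • v) = c • move g v :=
  Matrix.mulVec_smul _ _ _

theorem eval_actU2 (g : U2) (f : Poly2) (v : Fin 2 → ℂ) :
    eval v (actU2 g f) = eval (move g⁻¹ v) f := by
  have : (eval v).comp (actU2 g : Poly2 →+* Poly2) = eval (move g⁻¹ v) := by
    apply MvPolynomial.ringHom_ext
    · intro r
      simp [actU2]
    · intro i
      fin_cases i <;> simp [actU2, move]
  exact congrArg (fun φ : Poly2 →+* ℂ => φ f) this

theorem actU2_mul (g k : U2) (f : Poly2) : actU2 (g * k) f = actU2 g (actU2 k f) := by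
  apply MvPolynomial.funext
  intro v
  rw [eval_actU2, eval_actU2, eval_actU2, _root_.mul_inv_rev, move_mul]

theorem actU2_one (f : Poly2) : actU2 1 f = f := by
  apply MvPolynomial.funext
  intro v
  rw [eval_actU2, inv_one, move_one]

/-- The maximal ideal of polynomials vanishing at a point. -/
noncomputable def maxIdealAt (v : Fin 2 → ℂ) : Ideal Poly2 :=
  RingHom.ker (eval v)

theorem mem_maxIdealAt {v : Fin 2 → ℂ} {f : Poly2} : f ∈ maxIdealAt v ↔ eval v f = 0 :=
  RingHom.mem_ker

instance isMaximal_maxIdealAt (v : Fin 2 → ℂ) : (maxIdealAt v).IsMaximal :=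
  RingHom.ker_isMaximal_of_surjective _ fun c => ⟨C c, by simp⟩

theorem isCoprime_maxIdealAt {v w : Fin 2 → ℂ} (h : v ≠ w) :
    IsCoprime (maxIdealAt v) (maxIdealAt w) := by
  apply Ideal.isCoprime_of_isMaximal
  intro heq
  apply h
  funext i
  have hv : X i - C (v i) ∈ maxIdealAt v := by simp [mem_maxIdealAt]
  rw [heq, mem_maxIdealAt] at hv
  simpa [sub_eq_zero, eq_comm] using hv

theorem actU2_mem_maxIdealAt_pow (g : U2) (v : Fin 2 → ℂ) (N : ℕ) {f : Poly2}
    (hf : f ∈ maxIdealAt v ^ N) : actU2 g f ∈ maxIdealAt (move g v) ^ N := by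
  have hle : (maxIdealAt v).map (actU2 g) ≤ maxIdealAt (move g v) := by
    rw [Ideal.map_le_iff_le_comap]
    intro p hp
    rw [Ideal.mem_comap, mem_maxIdealAt, eval_actU2, move_inv_move]
    exact mem_maxIdealAt.1 hp
  have := Ideal.mem_map_of_mem (actU2 g) hf
  rw [Ideal.map_pow] at this
  exact Ideal.pow_right_mono hle N this

theorem exists_sub_one_mem_and_forall_mem (x : Fin 2 → ℂ) (T : Finset (Fin 2 → ℂ)) (N : ℕ)
    (hx : x ∉ T) :
    ∃ θ : Poly2, θ - 1 ∈ maxIdealAt x ^ N ∧ ∀ y ∈ T, θ ∈ maxIdealAt y ^ N := by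
  have hco : IsCoprime (maxIdealAt x ^ N) (⨅ y ∈ T, maxIdealAt y ^ N) :=
    Ideal.isCoprime_biInf fun y hy => (isCoprime_maxIdealAt (ne_of_mem_of_not_mem hy hx).symm).pow
  obtain ⟨a, ha, θ, hθ, h⟩ := Ideal.isCoprime_iff_exists.1 hco
  refine ⟨θ, ?_, fun y hy => ?_⟩
  · have : θ - 1 = -a := by linear_combination h
    rw [this]
    exact neg_mem ha
  · exact (Submodule.mem_iInf _).1 ((Submodule.mem_iInf _).1 hθ y) hy

theorem exists_forall_pow_mem_imp_mem (J : Ideal Poly2) (T : Finset (Fin 2 → ℂ))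
    (hJ : ∀ z, (∀ f ∈ J, eval z f = 0) → z ∈ T) :
    ∃ N₀, ∀ N ≥ N₀, ∀ f : Poly2, (∀ y ∈ T, f ∈ maxIdealAt y ^ N) → f ∈ J := by
  have hrad : (∏ y ∈ T, maxIdealAt y) ≤ J.radical := by
    rw [← MvPolynomial.vanishingIdeal_zeroLocus_eq_radical (K := ℂ)]
    intro f hf
    rw [MvPolynomial.mem_vanishingIdeal_iff]
    intro z hz
    have hzT : z ∈ T := hJ z fun p hp => by
      simpa [MvPolynomial.coe_aeval_eq_eval] using MvPolynomial.mem_zeroLocus_iff.1 hz p hp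
    have := (Ideal.prod_le_inf.trans (Finset.inf_le hzT)) hf
    simpa [MvPolynomial.coe_aeval_eq_eval] using mem_maxIdealAt.1 this
  obtain ⟨N₀, hN₀⟩ := Ideal.exists_pow_le_of_le_radical_of_fg hrad (IsNoetherian.noetherian _)
  refine ⟨N₀, fun N hN f hf => hN₀ ?_⟩
  rw [← Finset.prod_pow, Ideal.prod_eq_iInf_of_pairwise_isCoprime]
  · exact (Submodule.mem_iInf _).2 fun y => (Submodule.mem_iInf _).2 fun hy =>
      Ideal.pow_le_pow_right hN (hf y hy)
  · intro y _ z _ hyz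
    exact (isCoprime_maxIdealAt hyz).pow

/-- A vector spanning the orthogonal complement of `x`. -/
noncomputable def perp (x : Fin 2 → ℂ) : Fin 2 → ℂ := ![-star (x 1), star (x 0)]

open scoped ComplexOrder in
theorem star_dotProduct_self_ne_zero {x : Fin 2 → ℂ} (hx : x ≠ 0) : star x ⬝ᵥ x ≠ 0 :=
  mt dotProduct_star_self_eq_zero.1 hx

/-- The linear form vanishing at `x` that takes the value `1` at `perp x`. -/
noncomputable def normalForm (x : Fin 2 → ℂ) : Poly2 :=
  C (star x ⬝ᵥ x)⁻¹ * (C (x 0) * X 1 - C (x 1) * X 0)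

/-- The linear form vanishing at `perp x` that takes the value `1` at `x`. -/
noncomputable def axisForm (x : Fin 2 → ℂ) : Poly2 :=
  C (star x ⬝ᵥ x)⁻¹ * (C (star (x 0)) * X 0 + C (star (x 1)) * X 1)

theorem isHomogeneous_normalForm (x : Fin 2 → ℂ) : (normalForm x).IsHomogeneous 1 := by
  have h (c : ℂ) (i : Fin 2) : (C c * X i : Poly2).IsHomogeneous 1 := by
    simpa using (isHomogeneous_C (Fin 2) c).mul (isHomogeneous_X ℂ i)
  simpa only [normalForm, zero_add] using
    (isHomogeneous_C (Fin 2) (star x ⬝ᵥ x)⁻¹).mul ((h (x 0) 1).sub (h (x 1) 0))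

theorem eval_axisForm (x v : Fin 2 → ℂ) :
    eval v (axisForm x) = (star x ⬝ᵥ x)⁻¹ * (star x ⬝ᵥ v) := by
  simp [axisForm, dotProduct]

theorem eval_normalForm_self (x : Fin 2 → ℂ) : eval x (normalForm x) = 0 := by
  simp [normalForm, mul_comm]

theorem eval_normalForm_perp {x : Fin 2 → ℂ} (hx : x ≠ 0) :
    eval (perp x) (normalForm x) = 1 := by
  have h := star_dotProduct_self_ne_zero hx
  rw [normalForm]
  simp only [map_mul, eval_C, map_sub, eval_X, perp]
  rw [inv_mul_eq_one₀ h]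
  simp [dotProduct]
  ring

theorem eval_axisForm_self {x : Fin 2 → ℂ} (hx : x ≠ 0) : eval x (axisForm x) = 1 := by
  rw [eval_axisForm, inv_mul_cancel₀ (star_dotProduct_self_ne_zero hx)]

theorem eval_axisForm_perp (x : Fin 2 → ℂ) : eval (perp x) (axisForm x) = 0 := by
  simp [axisForm, perp]
  right
  ring

theorem X_eq_axisForm_add_normalForm {x : Fin 2 → ℂ} (hx : x ≠ 0) (i : Fin 2) :
    (X i : Poly2) = C (x i) * axisForm x + C (perp x i) * normalForm x := by
  have h : (C (star x ⬝ᵥ x)⁻¹ : Poly2) * C (star x ⬝ᵥ x) = 1 := by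
    rw [← C_mul, inv_mul_cancel₀ (star_dotProduct_self_ne_zero hx), C_1]
  have hD : (C (star x ⬝ᵥ x) : Poly2) = C (star (x 0)) * C (x 0) + C (star (x 1)) * C (x 1) := by
    simp [dotProduct]
  generalize hc : (C (star x ⬝ᵥ x)⁻¹ : Poly2) = c at h
  rw [axisForm, normalForm, hc]
  rw [hD] at h
  fin_cases i
  · simp only [perp, Fin.zero_eta, Matrix.cons_val_zero, map_neg]
    linear_combination (-X 0) * h
  · simp only [perp, Fin.mk_one, Matrix.cons_val_one, Matrix.cons_val_fin_one]
    linear_combination (-X 1) * h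

theorem eq_eval_axisForm_smul_add {x : Fin 2 → ℂ} (hx : x ≠ 0) (v : Fin 2 → ℂ) :
    v = eval v (axisForm x) • x + eval v (normalForm x) • perp x := by
  funext i
  have := congrArg (eval v) (X_eq_axisForm_add_normalForm hx i)
  simp only [map_add, map_mul, eval_C, eval_X] at this
  simpa [mul_comm] using this

theorem eval_move_axisForm {x : Fin 2 → ℂ} {h : U2} (hh : move h x = x) (v : Fin 2 → ℂ) :
    eval (move h v) (axisForm x) = eval v (axisForm x) := by
  have hinv : move h⁻¹ x = x := by rw [← (move_eq_iff h x x).1 hh]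
  have key : star x ᵥ* (h : Matrix (Fin 2) (Fin 2) ℂ) = star x := by
    conv_rhs => rw [← hinv]
    rw [move, Matrix.star_mulVec]
    simp [Matrix.star_eq_conjTranspose]
  rw [eval_axisForm, eval_axisForm, move, Matrix.dotProduct_mulVec, key]

/-- Restriction of polynomial functions to the affine line through `x` orthogonal to `x`. -/
noncomputable def restrictLine (x : Fin 2 → ℂ) : Poly2 →ₐ[ℂ] Polynomial ℂ :=
  aeval fun i => Polynomial.C (x i) + Polynomial.C (perp x i) * Polynomial.X

theorem eval_restrictLine (x : Fin 2 → ℂ) (t : ℂ) (f : Poly2) :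
    (restrictLine x f).eval t = eval (x + t • perp x) f := by
  have : (Polynomial.evalRingHom t).comp (restrictLine x : Poly2 →+* Polynomial ℂ) =
      eval (x + t • perp x) := by
    apply MvPolynomial.ringHom_ext
    · intro r
      simp [restrictLine]
    · intro i
      simp [restrictLine, mul_comm t]
  exact congrArg (fun φ : Poly2 →+* ℂ => φ f) this

theorem restrictLine_normalForm {x : Fin 2 → ℂ} (hx : x ≠ 0) :
    restrictLine x (normalForm x) = Polynomial.X := by
  apply Polynomial.funext
  intro t
  have hlin : eval (x + t • perp x) (normalForm x) =
      eval x (normalForm x) + t * eval (perp x) (normalForm x) := by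
    simp [normalForm]
    ring
  rw [eval_restrictLine, hlin, eval_normalForm_self, eval_normalForm_perp hx]
  simp

theorem X_pow_dvd_restrictLine {x : Fin 2 → ℂ} {N : ℕ} {f : Poly2}
    (hf : f ∈ maxIdealAt x ^ N) : Polynomial.X ^ N ∣ restrictLine x f := by
  have hle : (maxIdealAt x).map (restrictLine x) ≤ Ideal.span {Polynomial.X} := by
    rw [Ideal.map_le_iff_le_comap]
    intro p hp
    rw [Ideal.mem_comap, Ideal.mem_span_singleton, Polynomial.X_dvd_iff,
      Polynomial.coeff_zero_eq_eval_zero, eval_restrictLine]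
    simpa using mem_maxIdealAt.1 hp
  have := Ideal.mem_map_of_mem (restrictLine x) hf
  rw [Ideal.map_pow] at this
  have := Ideal.pow_right_mono hle N this
  rwa [Ideal.span_singleton_pow, Ideal.mem_span_singleton] at this

theorem exists_eq_mul_normalForm_pow_add {x : Fin 2 → ℂ} (hx : x ≠ 0) {n : ℕ} {f : Poly2}
    (hf : Polynomial.X ^ n ∣ restrictLine x f) :
    ∃ a b, f = a * normalForm x ^ n + b * (axisForm x - 1) := by
  let π := Ideal.Quotient.mkₐ ℂ (Ideal.span {axisForm x - 1})
  let s : Polynomial ℂ →ₐ[ℂ] Poly2 := Polynomial.aeval (normalForm x)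
  have hπ : (π.comp s).comp (restrictLine x) = π := by
    apply MvPolynomial.algHom_ext
    intro i
    simp only [AlgHom.comp_apply]
    apply Ideal.Quotient.eq.2
    rw [Ideal.mem_span_singleton]
    refine ⟨-C (x i), ?_⟩
    have hs : s (restrictLine x (X i)) = C (x i) + C (perp x i) * normalForm x := by
      simp [s, restrictLine, MvPolynomial.algebraMap_eq]
    rw [hs]
    linear_combination -X_eq_axisForm_add_normalForm hx i
  obtain ⟨c, hc⟩ := hf
  have hmem : f - s (restrictLine x f) ∈ Ideal.span {axisForm x - 1} :=
    Ideal.Quotient.eq.1 (DFunLike.congr_fun hπ f).symm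
  obtain ⟨b, hb⟩ := Ideal.mem_span_singleton.1 hmem
  refine ⟨s c, b, ?_⟩
  have hs : s (restrictLine x f) = normalForm x ^ n * s c := by
    rw [hc]
    simp [s]
  linear_combination hb + hs

/-- The ideal of `S = ℂ[X, Y]` generated by the `G`-invariant polynomials vanishing at `x`. -/
noncomputable def fiberIdeal (G : Subgroup U2) (x : Fin 2 → ℂ) : Ideal Poly2 :=
  Ideal.span {f | (∀ g ∈ G, actU2 g f = f) ∧ eval x f = 0}

/-- The sum of the translates of a polynomial under a finite group. -/
noncomputable def orbitSum (G : Subgroup U2) [Fintype G] (f : Poly2) : Poly2 :=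
  ∑ g : G, actU2 (g : U2) f

/-- The orbit of a point under a finite group. -/
noncomputable def orbitFinset (G : Subgroup U2) [Fintype G] (z : Fin 2 → ℂ) :
    Finset (Fin 2 → ℂ) :=
  Finset.univ.image fun g : G => move (g : U2) z

theorem mem_orbitFinset {G : Subgroup U2} [Fintype G] {z y : Fin 2 → ℂ} :
    y ∈ orbitFinset G z ↔ ∃ g ∈ G, move g z = y := by
  simp [orbitFinset]

theorem actU2_orbitSum (G : Subgroup U2) [Fintype G] {k : U2} (hk : k ∈ G) (f : Poly2) :
    actU2 k (orbitSum G f) = orbitSum G f := by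
  rw [orbitSum, map_sum]
  simp only [← actU2_mul]
  exact Fintype.sum_equiv (Equiv.mulLeft (⟨k, hk⟩ : G)) _ _ fun _ => rfl

theorem actU2_mem_fiberIdeal {G : Subgroup U2} {x : Fin 2 → ℂ} {g : U2} (hg : g ∈ G)
    {f : Poly2} (hf : f ∈ fiberIdeal G x) : actU2 g f ∈ fiberIdeal G x := by
  have : fiberIdeal G x ≤ (fiberIdeal G x).comap (actU2 g) := by
    rw [fiberIdeal, Ideal.span_le]
    intro p hp
    rw [SetLike.mem_coe, Ideal.mem_comap, hp.1 g hg]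
    exact Ideal.subset_span hp
  exact this hf

theorem mem_orbitFinset_of_forall_eval_eq_zero (G : Subgroup U2) [Fintype G]
    (x z : Fin 2 → ℂ) (hz : ∀ f ∈ fiberIdeal G x, eval z f = 0) : z ∈ orbitFinset G x := by
  by_contra hzx
  have hx : x ∉ orbitFinset G z := by
    rw [mem_orbitFinset]
    rintro ⟨g, hg, hgx⟩
    exact hzx (mem_orbitFinset.2 ⟨g⁻¹, inv_mem hg, by rw [← hgx, move_inv_move]⟩)
  obtain ⟨θ, hθx, hθ⟩ := exists_sub_one_mem_and_forall_mem x _ 1 hx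
  rw [pow_one, mem_maxIdealAt] at hθx
  let f : Poly2 := ∏ g : G, actU2 (g : U2) (θ - 1)
  have hf : f ∈ fiberIdeal G x := by
    refine Ideal.subset_span ⟨fun k hk => ?_, ?_⟩
    · simp only [f, map_prod, ← actU2_mul]
      exact Fintype.prod_equiv (Equiv.mulLeft (⟨k, hk⟩ : G)) _ _ fun _ => rfl
    · rw [map_prod]
      exact Finset.prod_eq_zero (Finset.mem_univ 1) (by rw [OneMemClass.coe_one, actU2_one, hθx])
  have hne : eval z f ≠ 0 := by
    rw [map_prod, Finset.prod_ne_zero_iff]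
    intro g _
    have := hθ _ (mem_orbitFinset.2 ⟨_, inv_mem g.2, rfl⟩)
    rw [pow_one, mem_maxIdealAt] at this
    rw [eval_actU2, map_sub, this]
    simp
  exact hne (hz f hf)

/-- `θ` agrees to order `N` with the indicator function of `x` on the `G`-orbit of `x`. -/
structure IsApproxIndicator (G : Subgroup U2) (x : Fin 2 → ℂ) (N : ℕ) (θ : Poly2) :
    Prop where
  sub_one_mem : θ - 1 ∈ maxIdealAt x ^ N
  mem : ∀ g ∈ G, move g x ≠ x → θ ∈ maxIdealAt (move g x) ^ N

theorem exists_isApproxIndicator (G : Subgroup U2) [Fintype G] (x : Fin 2 → ℂ) (e : ℕ) :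
    ∃ N θ, e ≤ N ∧ IsApproxIndicator G x N θ ∧
      ∀ f : Poly2, (∀ g ∈ G, f ∈ maxIdealAt (move g x) ^ N) → f ∈ fiberIdeal G x := by
  obtain ⟨N₀, hN₀⟩ := exists_forall_pow_mem_imp_mem (fiberIdeal G x) (orbitFinset G x)
    (mem_orbitFinset_of_forall_eval_eq_zero G x)
  obtain ⟨θ, hθx, hθ⟩ := exists_sub_one_mem_and_forall_mem x ((orbitFinset G x).erase x)
    (max N₀ e) (Finset.notMem_erase _ _)
  refine ⟨max N₀ e, θ, le_max_right _ _, ⟨hθx, fun g hg hne => hθ _ ?_⟩, fun f hf => ?_⟩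
  · exact Finset.mem_erase.2 ⟨hne, mem_orbitFinset.2 ⟨g, hg, rfl⟩⟩
  · refine hN₀ (max N₀ e) (le_max_left _ _) f fun y hy => ?_
    obtain ⟨g, hg, rfl⟩ := mem_orbitFinset.1 hy
    exact hf g hg

/-- The value at `1` of the truncation below degree `e` of the restriction of a polynomial to the
affine line through `x` orthogonal to `x`. -/
noncomputable def jetSum (x : Fin 2 → ℂ) (e : ℕ) : Poly2 →ₗ[ℂ] ℂ :=
  ∑ i ∈ Finset.range e, Polynomial.lcoeff ℂ i ∘ₗ (restrictLine x).toLinearMap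

theorem jetSum_apply (x : Fin 2 → ℂ) (e : ℕ) (f : Poly2) :
    jetSum x e f = ∑ i ∈ Finset.range e, (restrictLine x f).coeff i := by
  simp [jetSum, LinearMap.sum_apply]

theorem jetSum_eq_zero_of_dvd {x : Fin 2 → ℂ} {e : ℕ} {f : Poly2}
    (hf : Polynomial.X ^ e ∣ restrictLine x f) : jetSum x e f = 0 := by
  rw [jetSum_apply]
  exact Finset.sum_eq_zero fun i hi => Polynomial.X_pow_dvd_iff.1 hf i (Finset.mem_range.1 hi)

/-- The equivariant map from polynomials to functions on `G` whose kernel is the ideal generated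
by the invariants vanishing at `x`. -/
noncomputable def fiberMap (G : Subgroup U2) (x : Fin 2 → ℂ) (e : ℕ) : Poly2 →ₗ[ℂ] (G → ℂ) :=
  LinearMap.pi fun g => jetSum x e ∘ₗ (actU2 (g : U2)⁻¹).toLinearMap

theorem fiberMap_apply (G : Subgroup U2) (x : Fin 2 → ℂ) (e : ℕ) (f : Poly2) (g : G) :
    fiberMap G x e f g = jetSum x e (actU2 (g : U2)⁻¹ f) :=
  rfl

theorem fiberMap_actU2 (G : Subgroup U2) (x : Fin 2 → ℂ) (e : ℕ) (f : Poly2) (g : G) :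
    fiberMap G x e (actU2 (g : U2) f) = LinearMap.funLeft ℂ ℂ (fun k : G => g⁻¹ * k)
      (fiberMap G x e f) := by
  funext k
  have hinv : (((g⁻¹ * k : G) : U2))⁻¹ = (k : U2)⁻¹ * g := by
    rw [← Subgroup.coe_inv, _root_.mul_inv_rev, inv_inv, Subgroup.coe_mul, Subgroup.coe_inv]
  rw [LinearMap.funLeft_apply, fiberMap_apply, fiberMap_apply, ← actU2_mul, hinv]

theorem trace_funLeft_mul_left {G : Type*} [Group G] [Fintype G] (g : G) :
    LinearMap.trace ℂ (G → ℂ) (LinearMap.funLeft ℂ ℂ fun k => g⁻¹ * k) =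
      if g = 1 then (Fintype.card G : ℂ) else 0 := by
  rw [LinearMap.trace_eq_matrix_trace ℂ (Pi.basisFun ℂ G), Matrix.trace]
  simp only [Matrix.diag_apply, LinearMap.toMatrix_apply, Pi.basisFun_apply, Pi.basisFun_repr,
    LinearMap.funLeft_apply, Pi.single_apply]
  split_ifs with h <;> simp [h]

/-- `I` is the stabilizer in `G` of the point `x ≠ 0`, of order `e`, and `ε` is the character by
which `I` acts on the linear forms vanishing at `x`. -/
structure IsStabilizerCharacter (G I : Subgroup U2) (x : Fin 2 → ℂ) (e : ℕ) (ε : U2 → ℂ) :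
    Prop where
  ne_zero : x ≠ 0
  mem_iff : ∀ g, g ∈ I ↔ g ∈ G ∧ move g x = x
  card_eq : e = Nat.card I
  smul_eq : ∀ g ∈ I, ∀ a : Poly2, a.IsHomogeneous 1 → eval x a = 0 → actU2 g a = ε g • a

namespace IsStabilizerCharacter

variable {G I : Subgroup U2} {x : Fin 2 → ℂ} {e : ℕ} {ε : U2 → ℂ}

theorem le (H : IsStabilizerCharacter G I x e ε) : I ≤ G := fun g hg => ((H.mem_iff g).1 hg).1

theorem move_eq (H : IsStabilizerCharacter G I x e ε) {g : U2} (hg : g ∈ I) : move g x = x :=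
  ((H.mem_iff g).1 hg).2

theorem finite [Fintype G] (H : IsStabilizerCharacter G I x e ε) : Finite I :=
  Finite.of_injective _ (Subgroup.inclusion_injective H.le)

theorem pos [Fintype G] (H : IsStabilizerCharacter G I x e ε) : 0 < e := by
  have := H.finite
  rw [H.card_eq]
  exact Nat.card_pos

theorem actU2_normalForm (H : IsStabilizerCharacter G I x e ε) {g : U2} (hg : g ∈ I) :
    actU2 g (normalForm x) = ε g • normalForm x :=
  H.smul_eq g hg _ (isHomogeneous_normalForm x) (eval_normalForm_self x)

theorem actU2_axisForm (H : IsStabilizerCharacter G I x e ε) {g : U2} (hg : g ∈ I) :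
    actU2 g (axisForm x) = axisForm x := by
  apply MvPolynomial.funext
  intro v
  rw [eval_actU2, eval_move_axisForm (H.move_eq (inv_mem hg))]

theorem move_inv_perp (H : IsStabilizerCharacter G I x e ε) {g : U2} (hg : g ∈ I) :
    move g⁻¹ (perp x) = ε g • perp x := by
  have hn : eval (move g⁻¹ (perp x)) (normalForm x) = ε g := by
    rw [← eval_actU2, H.actU2_normalForm hg, smul_eval, eval_normalForm_perp H.ne_zero, mul_one]
  rw [eq_eval_axisForm_smul_add H.ne_zero (move g⁻¹ (perp x)),
    eval_move_axisForm (H.move_eq (inv_mem hg)), eval_axisForm_perp, hn, zero_smul, zero_add]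

theorem smul_normalForm_injective (H : IsStabilizerCharacter G I x e ε) {a b : ℂ}
    (h : a • normalForm x = b • normalForm x) : a = b := by
  have := congrArg (eval (perp x)) h
  simpa only [smul_eval, eval_normalForm_perp H.ne_zero, mul_one] using this

theorem char_one (H : IsStabilizerCharacter G I x e ε) : ε 1 = 1 := by
  apply H.smul_normalForm_injective
  rw [← H.actU2_normalForm (one_mem I), actU2_one, one_smul]

theorem char_mul (H : IsStabilizerCharacter G I x e ε) {g k : U2} (hg : g ∈ I) (hk : k ∈ I) :
    ε (g * k) = ε g * ε k := by
  apply H.smul_normalForm_injective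
  rw [← H.actU2_normalForm (mul_mem hg hk), actU2_mul, H.actU2_normalForm hk, map_smul,
    H.actU2_normalForm hg, smul_smul, mul_comm]

/-- The character of the stabilizer as a monoid homomorphism. -/
noncomputable def charHom (H : IsStabilizerCharacter G I x e ε) : I →* ℂ where
  toFun g := ε g
  map_one' := H.char_one
  map_mul' g k := H.char_mul g.2 k.2

theorem char_pow (H : IsStabilizerCharacter G I x e ε) {g : U2} (hg : g ∈ I) : ε g ^ e = 1 := by
  rw [H.card_eq]
  exact (map_pow H.charHom ⟨g, hg⟩ _).symm.trans (by rw [pow_card_eq_one', map_one])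

theorem eq_one_of_char_eq_one (H : IsStabilizerCharacter G I x e ε) {g : U2} (hg : g ∈ I)
    (h : ε g = 1) : g = 1 := by
  have hperp := H.move_inv_perp hg
  rw [h, one_smul] at hperp
  have hmove (v : Fin 2 → ℂ) : move g⁻¹ v = v := by
    rw [eq_eval_axisForm_smul_add H.ne_zero v, move_add, move_smul, move_smul, hperp,
      H.move_eq (inv_mem hg)]
  rw [← inv_eq_one]
  apply Subtype.ext
  apply Matrix.toLin'.injective
  apply LinearMap.ext
  intro v
  rw [Matrix.toLin'_apply, Matrix.toLin'_apply]
  exact (hmove v).trans (move_one v).symm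

theorem charHom_injective (H : IsStabilizerCharacter G I x e ε) :
    Function.Injective H.charHom := by
  rw [injective_iff_map_eq_one]
  intro g hg
  exact Subtype.ext (H.eq_one_of_char_eq_one g.2 hg)

theorem sum_char_pow (H : IsStabilizerCharacter G I x e ε) {g : U2} (hg : g ∈ I) :
    ∑ ν ∈ Finset.range e, ε g ^ ν = if g = 1 then (e : ℂ) else 0 := by
  split_ifs with h
  · simp [h, H.char_one]
  · have := geom_sum_mul (ε g) e
    rw [H.char_pow hg, sub_self, mul_eq_zero, sub_eq_zero] at this
    exact this.resolve_right fun h1 => h (H.eq_one_of_char_eq_one hg h1)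

theorem eq_zero_of_sum_mul_char_pow [Fintype G] (H : IsStabilizerCharacter G I x e ε) (c : ℕ → ℂ)
    (hc : ∀ g ∈ I, ∑ i ∈ Finset.range e, c i * ε g ^ i = 0) : ∀ i < e, c i = 0 := by
  have := H.finite
  have := Fintype.ofFinite I
  let p : Polynomial ℂ := ∑ i ∈ Finset.range e, Polynomial.C (c i) * Polynomial.X ^ i
  have hdeg : p.natDegree < e := by
    refine (Polynomial.natDegree_sum_le_of_forall_le _ _ (n := e - 1) fun i hi => ?_).trans_lt
      (Nat.sub_lt H.pos one_pos)
    have := Finset.mem_range.1 hi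
    exact (Polynomial.natDegree_C_mul_X_pow_le _ _).trans (by omega)
  have hp : p = 0 := by
    apply Polynomial.eq_zero_of_natDegree_lt_card_of_eval_eq_zero p H.charHom_injective
    · intro g
      simpa [p, Polynomial.eval_finsetSum, charHom] using hc g g.2
    · rwa [← Nat.card_eq_fintype_card, ← H.card_eq]
  intro i hi
  have := congrArg (fun q => Polynomial.coeff q i) hp
  simpa [p, Polynomial.coeff_C_mul, Polynomial.coeff_X_pow, hi] using this

theorem restrictLine_actU2 (H : IsStabilizerCharacter G I x e ε) {g : U2} (hg : g ∈ I)
    (f : Poly2) : restrictLine x (actU2 g f) =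
      (restrictLine x f).comp (Polynomial.C (ε g) * Polynomial.X) := by
  apply Polynomial.funext
  intro t
  rw [eval_restrictLine, eval_actU2, move_add, move_smul, H.move_inv_perp hg,
    H.move_eq (inv_mem hg), Polynomial.eval_comp, eval_restrictLine, smul_smul,
    mul_comm t]
  simp

theorem coeff_restrictLine_actU2 (H : IsStabilizerCharacter G I x e ε) {g : U2} (hg : g ∈ I)
    (f : Poly2) (i : ℕ) : (restrictLine x (actU2 g f)).coeff i =
      (restrictLine x f).coeff i * ε g ^ i := by
  rw [H.restrictLine_actU2 hg, Polynomial.comp_C_mul_X_coeff]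

theorem exists_char_pow_ne_one [Fintype G] (H : IsStabilizerCharacter G I x e ε) {i : ℕ}
    (hi : i ≠ 0) (hie : i < e) : ∃ g ∈ I, ε g ^ i ≠ 1 := by
  by_contra! h
  have := H.eq_zero_of_sum_mul_char_pow (fun j => (if j = i then 1 else 0) - if j = 0 then 1 else 0)
    (fun g hg => by simp [sub_mul, Finset.sum_sub_distrib, hie, H.pos, h g hg]) i hie
  simp [hi] at this

theorem X_pow_dvd_restrictLine_of_invariant [Fintype G] (H : IsStabilizerCharacter G I x e ε)
    {f : Poly2} (hf : ∀ g ∈ I, actU2 g f = f) (hfx : eval x f = 0) :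
    Polynomial.X ^ e ∣ restrictLine x f := by
  rw [Polynomial.X_pow_dvd_iff]
  intro i hi
  rcases eq_or_ne i 0 with rfl | h0
  · rw [Polynomial.coeff_zero_eq_eval_zero, eval_restrictLine]
    simpa using hfx
  · obtain ⟨g, hg, hne⟩ := H.exists_char_pow_ne_one h0 hi
    have := H.coeff_restrictLine_actU2 hg f i
    rw [hf g hg] at this
    by_contra hne0
    exact hne (mul_left_cancel₀ hne0 (by rw [← this, mul_one]))

theorem actU2_indicator_mem (H : IsStabilizerCharacter G I x e ε) {N : ℕ} {θ : Poly2}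
    (hθ : IsApproxIndicator G x N θ) {g : U2} (hg : g ∈ G) (hgI : g ∉ I) :
    actU2 g θ ∈ maxIdealAt x ^ N := by
  have hne : move g⁻¹ x ≠ x := fun h => hgI (inv_mem_iff.1 ((H.mem_iff _).2 ⟨inv_mem hg, h⟩))
  have := actU2_mem_maxIdealAt_pow g _ _ (hθ.mem _ (inv_mem hg) hne)
  rwa [move_move_inv] at this

theorem actU2_indicator_sub_one_mem (H : IsStabilizerCharacter G I x e ε) {N : ℕ} {θ : Poly2}
    (hθ : IsApproxIndicator G x N θ) {g : U2} (hg : g ∈ I) :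
    actU2 g θ - 1 ∈ maxIdealAt x ^ N := by
  have := actU2_mem_maxIdealAt_pow g _ _ hθ.sub_one_mem
  rwa [H.move_eq hg, map_sub, map_one] at this

theorem card_filter_mem [Fintype G] (H : IsStabilizerCharacter G I x e ε) :
    (Finset.univ.filter fun g : G => (g : U2) ∈ I).card = e := by
  rw [H.card_eq, ← Fintype.card_subtype, ← Nat.card_eq_fintype_card]
  exact Nat.card_congr (Equiv.subtypeSubtypeEquivSubtype fun {g} hg => H.le hg)

theorem orbitSum_sub_mem [Fintype G] (H : IsStabilizerCharacter G I x e ε) {N : ℕ} {θ : Poly2}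
    (hθ : IsApproxIndicator G x N θ) {q : Poly2} (hq : ∀ g ∈ I, actU2 g q = q) :
    orbitSum G (θ * q) - (e : Poly2) * q ∈ maxIdealAt x ^ N := by
  have : orbitSum G (θ * q) - (e : Poly2) * q =
      ∑ g : G, (actU2 (g : U2) (θ * q) - if (g : U2) ∈ I then q else 0) := by
    rw [Finset.sum_sub_distrib, orbitSum, Finset.sum_ite, Finset.sum_const_zero, add_zero,
      Finset.sum_const, H.card_filter_mem, nsmul_eq_mul]
  rw [this]
  refine sum_mem fun g _ => ?_
  rw [map_mul]
  split_ifs with hg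
  · rw [hq g hg, ← sub_one_mul]
    exact Ideal.mul_mem_right _ _ (H.actU2_indicator_sub_one_mem hθ hg)
  · rw [sub_zero]
    exact Ideal.mul_mem_right _ _ (H.actU2_indicator_mem hθ g.2 hg)

theorem mem_of_natCast_mul_mem [Fintype G] (H : IsStabilizerCharacter G I x e ε) {J : Ideal Poly2}
    {f : Poly2} (hf : (e : Poly2) * f ∈ J) : f ∈ J := by
  have he : (e : ℂ) ≠ 0 := Nat.cast_ne_zero.2 H.pos.ne'
  have := J.mul_mem_left (C (e : ℂ)⁻¹) hf
  rwa [← mul_assoc, ← map_natCast (C : ℂ →+* Poly2), ← C_mul, inv_mul_cancel₀ he, C_1,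
    one_mul] at this

theorem indicator_mul_invariant_mem [Fintype G] (H : IsStabilizerCharacter G I x e ε) {N : ℕ}
    {θ : Poly2} (hN : e ≤ N) (hθ : IsApproxIndicator G x N θ)
    (hJ : ∀ f : Poly2, (∀ g ∈ G, f ∈ maxIdealAt (move g x) ^ N) → f ∈ fiberIdeal G x)
    {q : Poly2} (hq : ∀ g ∈ I, actU2 g q = q) (hqx : eval x q = 0) : θ * q ∈ fiberIdeal G x := by
  have hsub := H.orbitSum_sub_mem hθ hq
  have hsum : orbitSum G (θ * q) ∈ fiberIdeal G x := by
    refine Ideal.subset_span ⟨fun g hg => actU2_orbitSum G hg _, ?_⟩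
    have := mem_maxIdealAt.1 (Ideal.pow_le_self (H.pos.trans_le hN).ne' hsub)
    rwa [map_sub, map_mul, hqx, mul_zero, sub_zero] at this
  have hdiff : θ * (orbitSum G (θ * q) - (e : Poly2) * q) ∈ fiberIdeal G x := by
    refine hJ _ fun g hg => ?_
    by_cases hgx : move g x = x
    · rw [hgx]
      exact Ideal.mul_mem_left _ _ hsub
    · exact Ideal.mul_mem_right _ _ (hθ.mem g hg hgx)
  apply H.mem_of_natCast_mul_mem
  have : (e : Poly2) * (θ * q) =
      θ * orbitSum G (θ * q) - θ * (orbitSum G (θ * q) - (e : Poly2) * q) := by ring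
  rw [this]
  exact sub_mem (Ideal.mul_mem_left _ _ hsum) hdiff

theorem indicator_mul_mem [Fintype G] (H : IsStabilizerCharacter G I x e ε) {N : ℕ}
    {θ : Poly2} (hN : e ≤ N) (hθ : IsApproxIndicator G x N θ)
    (hJ : ∀ f : Poly2, (∀ g ∈ G, f ∈ maxIdealAt (move g x) ^ N) → f ∈ fiberIdeal G x)
    {f : Poly2} (hf : Polynomial.X ^ e ∣ restrictLine x f) : θ * f ∈ fiberIdeal G x := by
  obtain ⟨a, b, rfl⟩ := exists_eq_mul_normalForm_pow_add H.ne_zero hf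
  have hn : θ * normalForm x ^ e ∈ fiberIdeal G x := by
    refine H.indicator_mul_invariant_mem hN hθ hJ (fun g hg => ?_) ?_
    · rw [map_pow, H.actU2_normalForm hg, smul_pow, H.char_pow hg, one_smul]
    · rw [map_pow, eval_normalForm_self, zero_pow H.pos.ne']
  have ha : θ * (axisForm x - 1) ∈ fiberIdeal G x := by
    refine H.indicator_mul_invariant_mem hN hθ hJ (fun g hg => ?_) ?_
    · rw [map_sub, map_one, H.actU2_axisForm hg]
    · rw [map_sub, map_one, eval_axisForm_self H.ne_zero, sub_self]
  have : θ * (a * normalForm x ^ e + b * (axisForm x - 1)) =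
      a * (θ * normalForm x ^ e) + b * (θ * (axisForm x - 1)) := by ring
  rw [this]
  exact add_mem (Ideal.mul_mem_left _ _ hn) (Ideal.mul_mem_left _ _ ha)

/-- A polynomial lies in the ideal as soon as the restrictions of all its translates vanish to
order `e`. -/
theorem mem_fiberIdeal_of_forall_dvd [Fintype G] (H : IsStabilizerCharacter G I x e ε) {f : Poly2}
    (hf : ∀ g ∈ G, Polynomial.X ^ e ∣ restrictLine x (actU2 g f)) : f ∈ fiberIdeal G x := by
  obtain ⟨N, θ, hN, hθ, hJ⟩ := exists_isApproxIndicator G x e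
  have hsum : orbitSum G θ * f ∈ fiberIdeal G x := by
    rw [orbitSum, Finset.sum_mul]
    refine sum_mem fun g _ => ?_
    have := actU2_mem_fiberIdeal g.2 (H.indicator_mul_mem hN hθ hJ (hf _ (inv_mem g.2)))
    rwa [map_mul, ← actU2_mul, mul_inv_cancel, actU2_one] at this
  have hdiff : orbitSum G θ - (e : Poly2) ∈ fiberIdeal G x := by
    refine hJ _ fun g hg => ?_
    have := actU2_mem_maxIdealAt_pow g _ _
      (H.orbitSum_sub_mem hθ (q := 1) fun g _ => map_one (actU2 g))
    rwa [mul_one, mul_one, map_sub, actU2_orbitSum G hg, map_natCast] at this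
  apply H.mem_of_natCast_mul_mem
  have : (e : Poly2) * f = orbitSum G θ * f - f * (orbitSum G θ - (e : Poly2)) := by ring
  rw [this]
  exact sub_mem hsum (Ideal.mul_mem_left _ _ hdiff)

theorem X_pow_dvd_restrictLine_of_mem [Fintype G] (H : IsStabilizerCharacter G I x e ε) {f : Poly2}
    (hf : f ∈ fiberIdeal G x) : Polynomial.X ^ e ∣ restrictLine x f := by
  have : fiberIdeal G x ≤ (Ideal.span {Polynomial.X ^ e}).comap (restrictLine x) := by
    rw [fiberIdeal, Ideal.span_le]
    intro p hp
    rw [SetLike.mem_coe, Ideal.mem_comap, Ideal.mem_span_singleton]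
    exact H.X_pow_dvd_restrictLine_of_invariant (fun g hg => hp.1 g (H.le hg)) hp.2
  exact Ideal.mem_span_singleton.1 (this hf)

theorem jetSum_actU2 (H : IsStabilizerCharacter G I x e ε) {g : U2} (hg : g ∈ I) (f : Poly2) :
    jetSum x e (actU2 g f) = ∑ i ∈ Finset.range e, (restrictLine x f).coeff i * ε g ^ i := by
  simp only [jetSum_apply, H.coeff_restrictLine_actU2 hg]

theorem ker_fiberMap [Fintype G] (H : IsStabilizerCharacter G I x e ε) :
    (fiberMap G x e).ker = (fiberIdeal G x).restrictScalars ℂ := by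
  ext f
  rw [LinearMap.mem_ker, Submodule.restrictScalars_mem, funext_iff]
  refine ⟨fun hf => H.mem_fiberIdeal_of_forall_dvd fun g hg => ?_, fun hf g => ?_⟩
  · rw [Polynomial.X_pow_dvd_iff]
    refine H.eq_zero_of_sum_mul_char_pow _ fun k hk => ?_
    have := hf ⟨(k * g)⁻¹, inv_mem (mul_mem (H.le hk) hg)⟩
    rwa [fiberMap_apply, inv_inv, actU2_mul, H.jetSum_actU2 hk] at this
  · exact jetSum_eq_zero_of_dvd
      (H.X_pow_dvd_restrictLine_of_mem (actU2_mem_fiberIdeal (inv_mem g.2) hf))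

theorem exists_fiberMap_eq_single [Fintype G] (H : IsStabilizerCharacter G I x e ε) :
    ∃ f, fiberMap G x e f = Pi.single 1 1 := by
  obtain ⟨N, θ, hN, hθ, -⟩ := exists_isApproxIndicator G x e
  have hdvd {f : Poly2} (hf : f ∈ maxIdealAt x ^ N) : jetSum x e f = 0 :=
    jetSum_eq_zero_of_dvd ((pow_dvd_pow _ hN).trans (X_pow_dvd_restrictLine hf))
  let q : Poly2 := (e : ℂ)⁻¹ • ∑ i ∈ Finset.range e, normalForm x ^ i
  have hq : ∀ i ∈ Finset.range e, (restrictLine x q).coeff i = (e : ℂ)⁻¹ := by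
    intro i hi
    simp only [q, map_smul, map_sum, map_pow, restrictLine_normalForm H.ne_zero]
    simp [Polynomial.coeff_X_pow, Finset.mem_range.1 hi]
  refine ⟨θ * q, funext fun g => ?_⟩
  rw [fiberMap_apply, map_mul]
  by_cases hg : ((g : U2)⁻¹) ∈ I
  · have hsub : jetSum x e (actU2 (g : U2)⁻¹ θ * actU2 (g : U2)⁻¹ q) =
        jetSum x e (actU2 (g : U2)⁻¹ q) := by
      rw [← sub_eq_zero, ← map_sub, ← sub_one_mul]
      exact hdvd (Ideal.mul_mem_right _ _ (H.actU2_indicator_sub_one_mem hθ hg))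
    rw [hsub, H.jetSum_actU2 hg, Finset.sum_congr rfl fun i hi => by rw [hq i hi],
      ← Finset.mul_sum, H.sum_char_pow hg]
    have he : (e : ℂ) ≠ 0 := Nat.cast_ne_zero.2 H.pos.ne'
    simp [Pi.single_apply, he]
  · rw [hdvd (Ideal.mul_mem_right _ _ (H.actU2_indicator_mem hθ (inv_mem g.2) hg))]
    have : g ≠ 1 := fun h => hg (by rw [h]; simp)
    rw [Pi.single_eq_of_ne this]

theorem fiberMap_surjective [Fintype G] (H : IsStabilizerCharacter G I x e ε) :
    Function.Surjective (fiberMap G x e) := by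
  obtain ⟨f, hf⟩ := H.exists_fiberMap_eq_single
  intro c
  refine ⟨∑ k : G, c k • actU2 (k : U2) f, funext fun g => ?_⟩
  simp only [map_sum, map_smul, fiberMap_actU2, hf, Finset.sum_apply, Pi.smul_apply,
    LinearMap.funLeft_apply, Pi.single_apply, inv_mul_eq_one]
  simp

/-- The quotient by the ideal generated by the invariants vanishing at `x` is isomorphic to the
space of functions on `G`. -/
noncomputable def quotientEquiv [Fintype G] (H : IsStabilizerCharacter G I x e ε) :
    (Poly2 ⧸ fiberIdeal G x) ≃ₗ[ℂ] (G → ℂ) :=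
  (Submodule.Quotient.restrictScalarsEquiv ℂ (fiberIdeal G x)).symm ≪≫ₗ
    Submodule.quotEquivOfEq _ _ H.ker_fiberMap.symm ≪≫ₗ
      (fiberMap G x e).quotKerEquivOfSurjective H.fiberMap_surjective

theorem quotientEquiv_mk [Fintype G] (H : IsStabilizerCharacter G I x e ε) (f : Poly2) :
    H.quotientEquiv (Ideal.Quotient.mk (fiberIdeal G x) f) = fiberMap G x e f :=
  rfl

/-- The action on the quotient has the character of the regular representation. -/
theorem trace_eq [Fintype G] (H : IsStabilizerCharacter G I x e ε) (g : G)
    (ρ : (Poly2 ⧸ fiberIdeal G x) →ₗ[ℂ] (Poly2 ⧸ fiberIdeal G x))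
    (hρ : ∀ f, ρ (Ideal.Quotient.mk _ f) = Ideal.Quotient.mk _ (actU2 (g : U2) f)) :
    LinearMap.trace ℂ _ ρ = if g = 1 then (Fintype.card G : ℂ) else 0 := by
  refine Eq.trans ?_ ((trace_funLeft_mul_left g).trans (by congr))
  rw [← LinearMap.trace_conj' ρ H.quotientEquiv]
  congr 1
  apply LinearMap.ext
  intro c
  obtain ⟨f, rfl⟩ := H.fiberMap_surjective c
  rw [LinearEquiv.conj_apply_apply, ← fiberMap_actU2, ← quotientEquiv_mk H f,
    LinearEquiv.symm_apply_apply, hρ, quotientEquiv_mk]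

/-- The sum of the characters induced from the powers of `ε` is the regular character. -/
theorem sum_induced_char [Fintype G] (H : IsStabilizerCharacter G I x e ε) (g : G) :
    (∑ ν ∈ Finset.range e, (e : ℂ)⁻¹ * ∑ k : G, if (k : U2)⁻¹ * g * k ∈ I
      then ε ((k : U2)⁻¹ * g * k) ^ ν else 0) = if g = 1 then (Fintype.card G : ℂ) else 0 := by
  have he : (e : ℂ) ≠ 0 := Nat.cast_ne_zero.2 H.pos.ne'
  have hk (k : G) : (∑ ν ∈ Finset.range e, if (k : U2)⁻¹ * g * k ∈ I
      then ε ((k : U2)⁻¹ * g * k) ^ ν else 0) = if g = 1 then (e : ℂ) else 0 := by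
    have hone : (k : U2)⁻¹ * g * k = 1 ↔ g = 1 := by
      rw [mul_eq_one_iff_eq_inv, inv_mul_eq_iff_eq_mul, mul_inv_cancel, OneMemClass.coe_eq_one]
    by_cases hmem : (k : U2)⁻¹ * g * k ∈ I
    · simp only [if_pos hmem, H.sum_char_pow hmem, hone]
    · have : g ≠ 1 := fun h => hmem (by rw [hone.2 h]; exact one_mem I)
      simp [hmem, this]
  rw [← Finset.mul_sum, Finset.sum_comm, Finset.sum_congr rfl fun k _ => hk k]
  split_ifs <;> simp [he, mul_comm]

end IsStabilizerCharacter

/-- Let `G` be a finite subgroup of U(2), `x ≠ 0` a point of ℂ² with stabilizer `I` of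
order `e`, and `ε` the character by which `I` acts on the line of linear forms vanishing
on `ℂx`.  Let `𝔪ₓ` be the ideal of `G`-invariant polynomials vanishing at `x` and
`J = S𝔪ₓ` the ideal it generates in `S = ℂ[X,Y]`, with `ρ` the induced action of `G`
on `S/S𝔪ₓ`.  Then `S/S𝔪ₓ` is finite-dimensional and isomorphic, as a representation of
`G`, to `⊕_{ν=0}^{e−1} Ind_I^G(ε^ν)`: the character of `ρ` equals the sum of the
induced characters. -/
theorem quotient_at_point_is_sum_of_induced
    (G : Subgroup (Matrix.unitaryGroup (Fin 2) ℂ)) [Fintype G]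
    (x : Fin 2 → ℂ) (hx : x ≠ 0)
    (I : Subgroup (Matrix.unitaryGroup (Fin 2) ℂ))
    (hI : ∀ g, g ∈ I ↔ g ∈ G ∧ (g : Matrix (Fin 2) (Fin 2) ℂ).mulVec x = x)
    (e : ℕ) (he : e = Nat.card I)
    (ε : Matrix.unitaryGroup (Fin 2) ℂ → ℂ)
    (hε : ∀ g ∈ I, ∀ a : MvPolynomial (Fin 2) ℂ, a.IsHomogeneous 1 →
      MvPolynomial.eval x a = 0 → actU2 g a = ε g • a)
    (J : Ideal (MvPolynomial (Fin 2) ℂ))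
    (hJ : J = Ideal.span {f | (∀ g ∈ G, actU2 g f = f) ∧ MvPolynomial.eval x f = 0})
    (ρ : G → (MvPolynomial (Fin 2) ℂ ⧸ J) →ₗ[ℂ] (MvPolynomial (Fin 2) ℂ ⧸ J))
    (hρ : ∀ (g : G) (f : MvPolynomial (Fin 2) ℂ),
      ρ g (Ideal.Quotient.mk J f) =
        Ideal.Quotient.mk J (actU2 (g : Matrix.unitaryGroup (Fin 2) ℂ) f)) :
    FiniteDimensional ℂ (MvPolynomial (Fin 2) ℂ ⧸ J) ∧
    ∀ g : G, LinearMap.trace ℂ (MvPolynomial (Fin 2) ℂ ⧸ J) (ρ g) =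
      ∑ ν ∈ Finset.range e, (e : ℂ)⁻¹ *
        ∑ k : G, if hk : ((k : Matrix.unitaryGroup (Fin 2) ℂ))⁻¹ * g * k ∈ I
          then (ε (((k : Matrix.unitaryGroup (Fin 2) ℂ))⁻¹ * g * k)) ^ ν else 0 := by
  have H : IsStabilizerCharacter G I x e ε := ⟨hx, hI, he, hε⟩
  change J = fiberIdeal G x at hJ
  subst hJ
  refine ⟨Module.Finite.equiv H.quotientEquiv.symm, fun g => ?_⟩
  rw [H.trace_eq g (ρ g) (hρ g), ← H.sum_induced_char g]
  simp only [dite_eq_ite]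
end

section
/- Let K' be a finite group and K a subgroup of index 2. Assume that for every s ∈ K' ∖ K and every k ∈ K, the element s k s⁻¹ is conjugate in K to k⁻¹. Then for all l, r ∈ K, the number of elements g ∈ K' with g⁻¹ l g = r equals Σ_χ χ(l)·(χ(r) + conj(χ(r))), where the sum runs over all irreducible complex characters χ of K. (Equivalently: the restriction to K × K of the biregular representation of K' × K' on ℂ[K'] decomposes as Σ_χ χ ⊗ (χ + conj(χ)).) -/
open CategoryTheory
open scoped MonoidAlgebra ComplexOrder Matrix

namespace Representation

variable {G V : Type*} [Group G] [AddCommGroup V] [Module ℂ V] [FiniteDimensional ℂ V]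

/-- The average of `ρ(g)ᴴ ρ(g)` is an invariant positive definite form, with respect to which
`ρ(x)⁻¹` is the adjoint of `ρ(x)`. -/
theorem character_inv_eq_conj [Fintype G] (ρ : Representation ℂ G V) (x : G) :
    ρ.character x⁻¹ = (starRingEnd ℂ) (ρ.character x) := by
  classical
  let b := Module.finBasis ℂ V
  let A : G →* Matrix (Fin (Module.finrank ℂ V)) (Fin (Module.finrank ℂ V)) ℂ :=
    (LinearMap.toMatrixAlgEquiv b : _ →* _).comp ρ
  have htrace (g : G) : ρ.character g = (A g).trace :=
    LinearMap.trace_eq_matrix_trace ℂ b (ρ g)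
  have hA (g : G) : A g⁻¹ * A g = 1 := by rw [← map_mul, inv_mul_cancel, map_one]
  have hA' (g : G) : A g * A g⁻¹ = 1 := by rw [← map_mul, mul_inv_cancel, map_one]
  let P := ∑ g : G, (A g)ᴴ * A g
  have hP : P.PosDef := Matrix.posDef_sum Finset.univ_nonempty fun g _ ↦
    Matrix.PosDef.conjTranspose_mul_self _ <| Matrix.mulVec_injective_of_isUnit
      ⟨⟨A g, A g⁻¹, hA' g, hA g⟩, rfl⟩
  have hinv : (A x)ᴴ * P * A x = P := by
    simp only [P, Finset.mul_sum, Finset.sum_mul]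
    refine Fintype.sum_equiv (Equiv.mulRight x) _ _ fun g ↦ ?_
    simp [mul_assoc]
  have hdet : IsUnit P.det := (Matrix.isUnit_iff_isUnit_det P).1 hP.isUnit
  have hadj : P * A x⁻¹ = (A x)ᴴ * P := by
    calc P * A x⁻¹ = (A x)ᴴ * P * A x * A x⁻¹ := by rw [hinv]
      _ = (A x)ᴴ * P := by rw [mul_assoc, hA', mul_one]
  have hconj : A x⁻¹ = P⁻¹ * ((A x)ᴴ * P) := by
    rw [← hadj, ← mul_assoc, Matrix.nonsing_inv_mul P hdet, one_mul]
  rw [htrace, htrace, hconj, Matrix.trace_mul_comm, mul_assoc, Matrix.mul_nonsing_inv P hdet,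
    mul_one, Matrix.trace_conjTranspose, starRingEnd_apply]

/-- If a class function `f` is orthogonal to the character of an irreducible representation, then
`∑ g, f g • g` acts on that representation as zero. -/
theorem asAlgebraHom_eq_zero_of_sum_mul_character_eq_zero [Fintype G] (ρ : Representation ℂ G V)
    [IsIrreducible ρ] (f : G → ℂ) (hf : ∀ g h, f (h * g * h⁻¹) = f g)
    (hsum : ∑ g, f g * ρ.character g = 0) :
    ρ.asAlgebraHom (∑ g, MonoidAlgebra.single g (f g)) = 0 := by
  have hφ : ρ.asAlgebraHom (∑ g, MonoidAlgebra.single g (f g)) = ∑ g, f g • ρ g := by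
    simp [map_sum, asAlgebraHom_single]
  have hcomm (h : G) : (∑ g, f g • ρ g) ∘ₗ ρ h = ρ h ∘ₗ ∑ g, f g • ρ g := by
    change (∑ g, f g • ρ g) * ρ h = ρ h * ∑ g, f g • ρ g
    simp only [Finset.sum_mul, Finset.mul_sum, smul_mul_assoc, mul_smul_comm, ← map_mul]
    refine (Fintype.sum_equiv (MulAut.conj h).toEquiv _ _ fun g ↦ ?_).symm
    simp [hf]
  obtain ⟨c, hc⟩ := (IsIrreducible.algebraMap_intertwiningMap_bijective_of_isAlgClosed
    (ρ := ρ)).surjective ⟨∑ g, f g • ρ g, hcomm⟩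
  have hc' : ∑ g, f g • ρ g = c • LinearMap.id := by
    have := congrArg IntertwiningMap.toLinearMap hc
    exact this.symm
  have htr : c * Module.finrank ℂ V = 0 := by
    have := congrArg (LinearMap.trace ℂ V) hc'
    simp only [map_sum, map_smul, LinearMap.trace_id, smul_eq_mul] at this
    rw [← this]
    exact hsum
  rw [hφ, hc']
  rcases mul_eq_zero.1 htr with h | h
  · rw [h, zero_smul]
  · have : Subsingleton V := Module.finrank_zero_iff.1 (by exact_mod_cast h)
    exact Subsingleton.elim _ _

section OfModule

variable {k G M : Type*} [Field k] [Group G] [AddCommGroup M] [Module k M] [Module k[G] M]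
  [IsScalarTower k k[G] M]

theorem asAlgebraHom_ofModule'_apply (a : k[G]) (m : M) :
    (ofModule' (k := k) (G := G) M).asAlgebraHom a m = a • m := by
  simp [asAlgebraHom, ofModule']

theorem isIrreducible_ofModule' (M : Type*) [AddCommGroup M] [Module k M] [Module k[G] M]
    [IsScalarTower k k[G] M] [IsSimpleModule k[G] M] :
    (ofModule' (k := k) (G := G) M).IsIrreducible := by
  let e : (ofModule' (k := k) (G := G) M).asModule ≃ₗ[k[G]] M :=
    { (ofModule' (k := k) (G := G) M).asModuleEquiv.toAddEquiv with
      map_smul' := fun a m ↦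
        ((ofModule' (k := k) (G := G) M).asModuleEquiv_map_smul a m).trans
          (asAlgebraHom_ofModule'_apply a _) }
  exact (irreducible_iff_isSimpleModule_asModule _).2 (IsSimpleModule.congr e)

end OfModule

end Representation

namespace FDRep

variable {G : Type} [Group G] [Fintype G]

theorem simple_of_isIrreducible {V : Type} [AddCommGroup V] [Module ℂ V] [FiniteDimensional ℂ V]
    (ρ : Representation ℂ G V) [ρ.IsIrreducible] : Simple (FDRep.of ρ) := by
  have := invertibleOfNonzero (NeZero.ne (Nat.card G : ℂ))
  rw [simple_iff_char_is_norm_one]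
  have h := Representation.char_orthonormal ρ ρ
  rw [if_pos ⟨.refl ρ⟩, inv_mul_eq_one₀ (NeZero.ne _)] at h
  exact h.symm

/-- If a class function `f` is orthogonal to all irreducible characters, then `∑ g, f g • g`
annihilates every simple module. -/
theorem sum_single_smul_eq_zero (f : G → ℂ) (hf : ∀ g h, f (h * g * h⁻¹) = f g)
    (hsum : ∀ W : FDRep ℂ G, Simple W → ∑ g, f g * W.character g = 0)
    {M : Type} [AddCommGroup M] [Module ℂ M] [Module ℂ[G] M] [IsScalarTower ℂ ℂ[G] M]
    [FiniteDimensional ℂ M] [IsSimpleModule ℂ[G] M] (m : M) :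
    (∑ g, MonoidAlgebra.single g (f g) : ℂ[G]) • m = 0 := by
  let ρ : Representation ℂ G M := Representation.ofModule' M
  have : ρ.IsIrreducible := Representation.isIrreducible_ofModule' M
  have h := ρ.asAlgebraHom_eq_zero_of_sum_mul_character_eq_zero f hf
    (hsum (.of ρ) (simple_of_isIrreducible ρ))
  rw [← Representation.asAlgebraHom_ofModule'_apply]
  exact LinearMap.congr_fun h m

/-- A class function orthogonal to all irreducible characters vanishes. -/
theorem eq_zero_of_forall_sum_mul_character_eq_zero (f : G → ℂ)
    (hf : ∀ g h, f (h * g * h⁻¹) = f g)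
    (hsum : ∀ W : FDRep ℂ G, Simple W → ∑ g, f g * W.character g = 0) : f = 0 := by
  classical
  have hmem : (∑ g, MonoidAlgebra.single g (f g) : ℂ[G]) ∈ Ring.jacobson ℂ[G] := by
    refine (Submodule.mem_sInf).2 fun I hI ↦ ?_
    have : IsSimpleModule ℂ[G] (ℂ[G] ⧸ I) := isSimpleModule_iff_isCoatom.2 hI
    have : Module.Finite ℂ (ℂ[G] ⧸ I) := Module.Finite.trans ℂ[G] _
    have h := sum_single_smul_eq_zero f hf hsum (Submodule.Quotient.mk (p := I) 1)
    rw [← Submodule.Quotient.mk_smul, smul_eq_mul, mul_one] at h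
    exact (Submodule.Quotient.mk_eq_zero I).1 h
  rw [IsSemisimpleRing.jacobson_eq_bot, Submodule.mem_bot] at hmem
  ext x
  simpa [MonoidAlgebra.coeff_sum, Finsupp.single_apply] using
    DFunLike.congr_fun (congrArg MonoidAlgebra.coeff hmem) x

/-- The second orthogonality relation for characters. -/
theorem card_conj_eq_sum_character_mul_character_inv {ι : Type*} [Fintype ι] (V : ι → FDRep ℂ G)
    (hsimple : ∀ i, Simple (V i))
    (hpairwise : ∀ i j, i ≠ j → IsEmpty (V i ≅ V j))
    (hcomplete : ∀ W : FDRep ℂ G, Simple W → ∃ i, Nonempty (W ≅ V i)) (l x : G) :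
    (Nat.card {g : G // g⁻¹ * l * g = x} : ℂ) =
      ∑ i, (V i).character l * (V i).character x⁻¹ := by
  classical
  have := invertibleOfNonzero (NeZero.ne (Nat.card G : ℂ))
  have horth (i j : ι) : ∑ x, (V i).character x⁻¹ * (V j).character x =
      if i = j then (Nat.card G : ℂ) else 0 := by
    have h := char_orthonormal (V j) (V i)
    rw [inv_mul_eq_iff_eq_mul₀ (NeZero.ne _)] at h
    simp_rw [mul_comm ((V i).character _)]
    rw [h]
    by_cases hij : i = j
    · subst hij
      simp [Nonempty.intro (Iso.refl (V i))]
    · simp [hij, hpairwise j i (Ne.symm hij)]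
  have hcard (x : G) : (Nat.card {g : G // g⁻¹ * l * g = x} : ℂ) =
      ∑ g : G, if g⁻¹ * l * g = x then 1 else 0 := by
    simp [Fintype.card_subtype]
  let f : G → ℂ := fun x ↦ (∑ g : G, if g⁻¹ * l * g = x then 1 else 0) -
    ∑ i, (V i).character l * (V i).character x⁻¹
  have hf : f = 0 := by
    refine eq_zero_of_forall_sum_mul_character_eq_zero f (fun g h ↦ ?_) fun W hW ↦ ?_
    · have hinv : (h * g * h⁻¹)⁻¹ = h * g⁻¹ * h⁻¹ := by group
      simp only [f, hinv, char_conj]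
      congr 1
      refine Fintype.sum_equiv (Equiv.mulRight h) _ _ fun y ↦ ?_
      refine if_congr ?_ rfl rfl
      rw [Equiv.coe_mulRight, eq_mul_inv_iff_mul_eq, ← inv_mul_eq_iff_eq_mul]
      simp only [mul_inv_rev, mul_assoc]
    · obtain ⟨j, ⟨e⟩⟩ := hcomplete W hW
      rw [char_iso e]
      simp only [f, sub_mul, Finset.sum_sub_distrib, Finset.sum_mul]
      rw [sub_eq_zero, Finset.sum_comm]
      conv_rhs => rw [Finset.sum_comm]
      have hleft (g : G) : ∑ x, (if g⁻¹ * l * g = x then 1 else 0) * (V j).character x =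
          (V j).character l := by
        simpa using (V j).char_conj l g⁻¹
      simp_rw [hleft, mul_assoc, ← Finset.mul_sum, horth]
      simp [mul_comm]
  rw [hcard]
  exact sub_eq_zero.1 (congrFun hf x)

end FDRep

theorem Subgroup.card_subtype_eq_add_of_index_eq_two {G : Type*} [Group G] [Finite G]
    {K : Subgroup G} (hK : K.index = 2) {t : G} (ht : t ∉ K) (p : G → Prop) :
    Nat.card {g // p g} = Nat.card {k : K // p k} + Nat.card {k : K // p (t * k)} := by
  have hmem (k : G) : t * k ∉ K ↔ k ∈ K := by
    simp [Subgroup.mul_mem_iff_of_index_two hK, ht]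
  have e : {k : K // p (t * k)} ≃ {g : {g // p g} // (g : G) ∉ K} :=
    { toFun k := ⟨⟨t * k, k.2⟩, (hmem _).2 k.1.2⟩
      invFun g := ⟨⟨t⁻¹ * g, (hmem _).1 (by simpa using g.2)⟩, by simpa using g.1.2⟩
      left_inv k := by simp
      right_inv g := by simp }
  have e' : {k : K // p k} ≃ {g : {g // p g} // (g : G) ∈ K} :=
    (Equiv.subtypeSubtypeEquivSubtypeInter _ _).trans <|
      (Equiv.subtypeEquivRight fun _ ↦ and_comm).trans
      (Equiv.subtypeSubtypeEquivSubtypeInter _ _).symm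
  classical
  rw [Nat.card_congr e, Nat.card_congr e', ← Nat.card_sum]
  exact Nat.card_congr (Equiv.sumCompl _).symm

/-- Let `K'` be a finite group and `K` a subgroup of index 2 such that conjugation by any
element outside `K` sends each element of `K` to a `K`-conjugate of its inverse.  Then for
all `l, r ∈ K`, the number of `g ∈ K'` with `g⁻¹ l g = r` equals
`Σ_χ χ(l)·(χ(r) + conj(χ(r)))`, the sum running over the irreducible complex characters
of `K` (here represented by a complete family `V i` of pairwise non-isomorphic irreducible
representations).  Equivalently: the biregular representation of `K' × K'` restricted to
`K × K` decomposes as `Σ_χ χ ⊗ (χ + conj χ)`. -/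
theorem biregular_restriction_character
    (K' : Type) [Group K'] [Fintype K']
    (K : Subgroup K') (hidx : K.index = 2)
    (hconj : ∀ s ∉ K, ∀ k ∈ K, ∃ c ∈ K, c * (s * k * s⁻¹) * c⁻¹ = k⁻¹)
    {ι : Type} [Fintype ι] (V : ι → FDRep ℂ K)
    (hsimple : ∀ i, Simple (V i))
    (hpairwise : ∀ i j, i ≠ j → IsEmpty (V i ≅ V j))
    (hcomplete : ∀ W : FDRep ℂ K, Simple W → ∃ i, Nonempty (W ≅ V i)) :
    ∀ l r : K,
      (Nat.card {g : K' // g⁻¹ * (l : K') * g = (r : K')} : ℂ) =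
        ∑ i : ι, (V i).character l *
          ((V i).character r + (starRingEnd ℂ) ((V i).character r)) := by
  intro l r
  have : Fintype K := Fintype.ofFinite K
  obtain ⟨s, hs⟩ : ∃ s, s ∉ K := by
    by_contra! h
    simp [(Subgroup.eq_top_iff' K).2 h] at hidx
  obtain ⟨c, hc, hcl⟩ := hconj s⁻¹ (by simpa using hs) l l.2
  have ht : s * c⁻¹ ∉ K := by rwa [K.mul_mem_cancel_right (K.inv_mem hc)]
  have hK : Nat.card {k : K // (k : K')⁻¹ * l * k = r} = Nat.card {k : K // k⁻¹ * l * k = r} :=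
    Nat.card_congr <| Equiv.subtypeEquivRight fun k ↦ by simp [Subtype.ext_iff]
  have hsK : Nat.card {k : K // (s * c⁻¹ * k)⁻¹ * l * (s * c⁻¹ * k) = r} =
      Nat.card {k : K // k⁻¹ * l * k = r⁻¹} := by
    refine Nat.card_congr <| Equiv.subtypeEquivRight fun k ↦ ?_
    have : (s * c⁻¹ * k)⁻¹ * l * (s * c⁻¹ * k) = (k : K')⁻¹ * (l : K')⁻¹ * k := by
      rw [← hcl]; group
    rw [this, ← inv_inj, Subtype.ext_iff]
    simp [mul_assoc]
  rw [Subgroup.card_subtype_eq_add_of_index_eq_two hidx ht, hK, hsK, Nat.cast_add,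
    FDRep.card_conj_eq_sum_character_mul_character_inv V hsimple hpairwise hcomplete,
    FDRep.card_conj_eq_sum_character_mul_character_inv V hsimple hpairwise hcomplete,
    ← Finset.sum_add_distrib]
  refine Finset.sum_congr rfl fun i _ ↦ ?_
  have hbar : (V i).character r⁻¹ = (starRingEnd ℂ) ((V i).character r) :=
    Representation.character_inv_eq_conj (V i).ρ r
  rw [inv_inv, hbar]
  ring
end

section
/- Let G be a finite subgroup of U(2) generated by reflections, and suppose the invariant ring R = S^G equals ℂ[f₁, f₂] for two algebraically independent homogeneous polynomials f₁, f₂ of degrees d₁, d₂. Let F = S/S𝔪₀ be the coinvariant algebra with graded pieces F_k. Then for every g ∈ G the following identity of polynomials in ℂ[t] holds: det(I − t·ρ(g)) · Σ_k tr(g | F_k) t^k = (1 − t^{d₁})(1 − t^{d₂}), where ρ(g) denotes the action of g on the two-dimensional space of linear forms ℂX + ℂY (via f ↦ f∘g⁻¹) and tr(g | F_k) is the trace of g acting on F_k. -/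
open Matrix MvPolynomial

/-- A reflection in U(2). -/
def IsReflectionU2 (g : Matrix.unitaryGroup (Fin 2) ℂ) : Prop :=
  g ≠ 1 ∧ IsOfFinOrder g ∧
    ∃ P : Submodule ℂ (Fin 2 → ℂ), Module.finrank ℂ P = 1 ∧
      ∀ v ∈ P, (g : Matrix (Fin 2) (Fin 2) ℂ).mulVec v = v

/-- The `k`-th graded piece `F_k` of `S/J`: the image of the homogeneous polynomials of
degree `k` under the quotient map. -/
noncomputable def gradedPiece (J : Ideal (MvPolynomial (Fin 2) ℂ)) (k : ℕ) :
    Submodule ℂ (MvPolynomial (Fin 2) ℂ ⧸ J) :=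
  (MvPolynomial.homogeneousSubmodule (Fin 2) ℂ k).map
    (Ideal.Quotient.mkₐ ℂ J).toLinearMap

/-- The characteristic-type polynomial `det(I − t·ρ(g)) ∈ ℂ[t]`, where `ρ(g)` is the
action of `g` on the space of linear forms `ℂX + ℂY` via `f ↦ f ∘ g⁻¹`; in the basis
`X, Y` this action has matrix `(g⁻¹)ᵀ`. -/
noncomputable def detOneSubT (g : Matrix.unitaryGroup (Fin 2) ℂ) : Polynomial ℂ :=
  Matrix.det
    ((1 : Matrix (Fin 2) (Fin 2) (Polynomial ℂ)) -
      (Polynomial.X : Polynomial ℂ) •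
        (((g⁻¹ : Matrix.unitaryGroup (Fin 2) ℂ) : Matrix (Fin 2) (Fin 2) ℂ)ᵀ).map
          Polynomial.C)

/-- An endomorphism of the middle term of a short exact sequence that is compatible with
endomorphisms of the outer terms has trace the sum of the outer traces. -/
theorem LinearMap.trace_eq_add_of_exact {K U V W : Type*} [Field K]
    [AddCommGroup U] [Module K U] [AddCommGroup V] [Module K V] [AddCommGroup W] [Module K W]
    [FiniteDimensional K V]
    {ι : U →ₗ[K] V} {φ : V →ₗ[K] W} (hι : Function.Injective ι) (hφ : Function.Surjective φ)
    (hex : Function.Exact ι φ)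
    {u : U →ₗ[K] U} {f : V →ₗ[K] V} {h : W →ₗ[K] W}
    (hu : ι ∘ₗ u = f ∘ₗ ι) (hh : h ∘ₗ φ = φ ∘ₗ f) :
    LinearMap.trace K V f = LinearMap.trace K U u + LinearMap.trace K W h := by
  have : FiniteDimensional K U := FiniteDimensional.of_injective ι hι
  have : FiniteDimensional K W := FiniteDimensional.of_surjective φ hφ
  obtain ⟨s, hs⟩ := φ.exists_rightInverse_of_surjective (LinearMap.range_eq_top.mpr hφ)
  have hs' (w : W) : φ (s w) = w := LinearMap.congr_fun hs w
  have hmem (v : V) : (LinearMap.id - s ∘ₗ φ : V →ₗ[K] V) v ∈ LinearMap.range ι := by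
    rw [LinearMap.mem_range, ← Set.mem_range, ← hex]
    simp [hs']
  let π : V →ₗ[K] U := (LinearEquiv.ofInjective ι hι).symm ∘ₗ
    (LinearMap.id - s ∘ₗ φ : V →ₗ[K] V).codRestrict (LinearMap.range ι) hmem
  have hπ : ι ∘ₗ π = LinearMap.id - s ∘ₗ φ := by
    ext v
    exact congrArg Subtype.val ((LinearEquiv.ofInjective ι hι).apply_symm_apply
      ((LinearMap.id - s ∘ₗ φ : V →ₗ[K] V).codRestrict _ hmem v))
  have hπu : π ∘ₗ f ∘ₗ ι = u := by
    ext x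
    apply hι
    have h1 := LinearMap.congr_fun hπ (f (ι x))
    have h2 : φ (ι (u x)) = 0 := hex.apply_apply_eq_zero _
    have h3 := LinearMap.congr_fun hu x
    simp only [LinearMap.comp_apply, LinearMap.sub_apply, LinearMap.id_apply] at h1 h3 ⊢
    rw [h1, ← h3, h2, map_zero, sub_zero]
  have hsplit : f = (f ∘ₗ ι) ∘ₗ π + (f ∘ₗ s) ∘ₗ φ := by
    rw [LinearMap.comp_assoc, hπ]
    ext v
    simp
  conv_lhs => rw [hsplit]
  rw [map_add, LinearMap.trace_comp_comm' π, hπu, LinearMap.trace_comp_comm' φ,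
    ← LinearMap.comp_assoc, ← hh, LinearMap.comp_assoc, hs, LinearMap.comp_id]

section TraceOn

variable {K V W : Type*} [Field K] [AddCommGroup V] [Module K V] [AddCommGroup W] [Module K W]

open Classical in
/-- The trace of an endomorphism on an invariant subspace; zero if the subspace is not
invariant. -/
noncomputable def traceOn (T : V →ₗ[K] V) (P : Submodule K V) : K :=
  if h : ∀ x ∈ P, T x ∈ P then LinearMap.trace K P (T.restrict h) else 0

theorem traceOn_eq {T : V →ₗ[K] V} {P : Submodule K V} (h : ∀ x ∈ P, T x ∈ P) :
    traceOn T P = LinearMap.trace K P (T.restrict h) :=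
  dif_pos h

theorem traceOn_bot (T : V →ₗ[K] V) : traceOn T ⊥ = 0 := by
  rw [traceOn_eq (by simp), Subsingleton.elim (T.restrict _) 0, map_zero]

theorem traceOn_sup_add_traceOn_inf {T : V →ₗ[K] V} {P Q : Submodule K V}
    [FiniteDimensional K P] [FiniteDimensional K Q]
    (hP : ∀ x ∈ P, T x ∈ P) (hQ : ∀ x ∈ Q, T x ∈ Q) :
    traceOn T (P ⊔ Q) + traceOn T (P ⊓ Q) = traceOn T P + traceOn T Q := by
  have hsup : ∀ x ∈ P ⊔ Q, T x ∈ P ⊔ Q := by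
    intro x hx
    obtain ⟨p, hp, q, hq, rfl⟩ := Submodule.mem_sup.mp hx
    rw [map_add]
    exact Submodule.add_mem_sup (hP p hp) (hQ q hq)
  have hinf : ∀ x ∈ P ⊓ Q, T x ∈ P ⊓ Q := fun x hx => ⟨hP x hx.1, hQ x hx.2⟩
  rw [traceOn_eq hP, traceOn_eq hQ, traceOn_eq hsup, traceOn_eq hinf,
    add_comm, eq_comm, ← LinearMap.trace_prodMap']
  refine LinearMap.trace_eq_add_of_exact (U := ↥(P ⊓ Q)) (V := P × Q) (W := ↥(P ⊔ Q))
    (ι := (Submodule.inclusion inf_le_left).prod (-Submodule.inclusion inf_le_right))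
    (φ := (Submodule.inclusion le_sup_left).coprod (Submodule.inclusion le_sup_right))
    ?_ ?_ ?_ ?_ ?_
  · intro x y hxy
    exact Submodule.inclusion_injective _ (Prod.ext_iff.mp hxy).1
  · rintro ⟨x, hx⟩
    obtain ⟨p, hp, q, hq, rfl⟩ := Submodule.mem_sup.mp hx
    exact ⟨(⟨p, hp⟩, ⟨q, hq⟩), rfl⟩
  · rintro ⟨⟨p, hp⟩, ⟨q, hq⟩⟩
    constructor
    · intro h
      have h' : p + q = 0 := congrArg Subtype.val h
      have hpq : q = -p := (neg_eq_of_add_eq_zero_right h').symm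
      subst hpq
      exact ⟨⟨p, hp, by simpa using hq⟩, rfl⟩
    · rintro ⟨x, hx⟩
      rw [← hx]
      apply Subtype.ext
      exact add_neg_cancel (x : V)
  · ext x
    · rfl
    · exact (map_neg T (x : V)).symm
  · exact LinearMap.ext fun x => Subtype.ext (map_add T (x.1 : V) (x.2 : V))

theorem traceOn_eq_add_trace_of_surjective {T : V →ₗ[K] V} {P Q : Submodule K V}
    [FiniteDimensional K P] (hP : ∀ x ∈ P, T x ∈ P) (hQ : ∀ x ∈ Q, T x ∈ Q) (hQP : Q ≤ P)
    {φ : P →ₗ[K] W} (hφ : Function.Surjective φ) (hker : ∀ x : P, φ x = 0 ↔ (x : V) ∈ Q)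
    {h : W →ₗ[K] W} (hh : ∀ x : P, h (φ x) = φ ⟨T x, hP x x.2⟩) :
    traceOn T P = traceOn T Q + LinearMap.trace K W h := by
  rw [traceOn_eq hP, traceOn_eq hQ]
  refine LinearMap.trace_eq_add_of_exact (ι := Submodule.inclusion hQP)
    (Submodule.inclusion_injective hQP) hφ (fun x => ?_) rfl (LinearMap.ext hh)
  rw [hker]
  exact ⟨fun hx => ⟨⟨x, hx⟩, rfl⟩, by rintro ⟨y, rfl⟩; exact y.2⟩

theorem traceOn_map_of_injective {T : V →ₗ[K] V} {P : Submodule K V}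
    {m : V →ₗ[K] V} (hm : Function.Injective m)
    {c : K} (hP : ∀ x ∈ P, T x ∈ P) (hTm : ∀ x ∈ P, T (m x) = c • m (T x)) :
    traceOn T (P.map m) = c * traceOn T P := by
  have hmap : ∀ x ∈ P.map m, T x ∈ P.map m := by
    rintro _ ⟨x, hx, rfl⟩
    rw [hTm x hx]
    exact Submodule.smul_mem _ _ ⟨T x, hP x hx, rfl⟩
  rw [traceOn_eq hP, traceOn_eq hmap, ← smul_eq_mul, ← map_smul,
    ← LinearMap.trace_conj' _ (Submodule.equivMapOfInjective m hm P)]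
  congr 1
  ext y
  obtain ⟨x, rfl⟩ := (Submodule.equivMapOfInjective m hm P).surjective y
  simp [LinearEquiv.conj_apply, hTm]

end TraceOn

namespace MvPolynomial

variable {σ K : Type*} [Field K]

instance [Finite σ] (k : ℕ) : FiniteDimensional K (homogeneousSubmodule σ K k) :=
  Module.Finite.iff_fg.mpr (homogeneousSubmodule_fg σ K k)

theorem homogeneousComponent_mul_of_isHomogeneous {a : MvPolynomial σ K} {d : ℕ}
    (ha : a.IsHomogeneous d) (q : MvPolynomial σ K) (k : ℕ) :
    homogeneousComponent k (a * q) =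
      if d ≤ k then a * homogeneousComponent (k - d) q else 0 := by
  let _ : GradedAlgebra (homogeneousSubmodule σ K) := gradedAlgebra
  have h := DirectSum.coe_decompose_mul_of_left_mem (homogeneousSubmodule σ K) (i := d) k
    (b := q) ha
  have hdec (p : MvPolynomial σ K) (i : ℕ) :
      (DirectSum.decompose (homogeneousSubmodule σ K) p i : MvPolynomial σ K) =
        homogeneousComponent i p := decomposition.decompose'_apply p i
  simpa only [hdec] using h

/-- The homogeneous elements of degree `k` in an ideal. -/
noncomputable def gradedPart (I : Ideal (MvPolynomial σ K)) (k : ℕ) :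
    Submodule K (MvPolynomial σ K) :=
  I.restrictScalars K ⊓ homogeneousSubmodule σ K k

theorem mem_gradedPart {I : Ideal (MvPolynomial σ K)} {k : ℕ} {x : MvPolynomial σ K} :
    x ∈ gradedPart I k ↔ x ∈ I ∧ x.IsHomogeneous k :=
  Iff.rfl

theorem gradedPart_inf (I I' : Ideal (MvPolynomial σ K)) (k : ℕ) :
    gradedPart I k ⊓ gradedPart I' k = gradedPart (I ⊓ I') k := by
  ext x
  simp only [Submodule.mem_inf, mem_gradedPart]
  tauto

instance [Finite σ] (I : Ideal (MvPolynomial σ K)) (k : ℕ) :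
    FiniteDimensional K (gradedPart I k) :=
  Submodule.finiteDimensional_of_le (inf_le_right : _ ≤ homogeneousSubmodule σ K k)

theorem gradedPart_span_singleton_of_le {a : MvPolynomial σ K} {d k : ℕ}
    (ha : a.IsHomogeneous d) (hdk : d ≤ k) :
    gradedPart (Ideal.span {a}) k =
      (homogeneousSubmodule σ K (k - d)).map (LinearMap.mulLeft K a) := by
  ext x
  rw [mem_gradedPart, Ideal.mem_span_singleton']
  constructor
  · rintro ⟨⟨q, rfl⟩, hx⟩
    refine ⟨homogeneousComponent (k - d) q, homogeneousComponent_mem _ _, ?_⟩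
    have h := homogeneousComponent_mul_of_isHomogeneous ha q k
    rw [if_pos hdk, mul_comm a q, homogeneousComponent_eq_self hx] at h
    exact h.symm
  · rintro ⟨q, hq, rfl⟩
    refine ⟨⟨q, mul_comm _ _⟩, ?_⟩
    have := ha.mul ((mem_homogeneousSubmodule _ _).mp hq)
    rwa [Nat.add_sub_cancel' hdk] at this

theorem gradedPart_span_singleton_of_lt {a : MvPolynomial σ K} {d k : ℕ}
    (ha : a.IsHomogeneous d) (hdk : k < d) :
    gradedPart (Ideal.span {a}) k = ⊥ := by
  rw [eq_bot_iff]
  intro x hx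
  obtain ⟨hx, hk⟩ := mem_gradedPart.mp hx
  obtain ⟨q, rfl⟩ := Ideal.mem_span_singleton'.mp hx
  have h := homogeneousComponent_mul_of_isHomogeneous ha q k
  rw [if_neg hdk.not_ge, mul_comm a q, homogeneousComponent_eq_self hk] at h
  exact h

theorem gradedPart_span_pair {a b : MvPolynomial σ K} {d e : ℕ}
    (ha : a.IsHomogeneous d) (hb : b.IsHomogeneous e) (k : ℕ) :
    gradedPart (Ideal.span {a, b}) k =
      gradedPart (Ideal.span {a}) k ⊔ gradedPart (Ideal.span {b}) k := by
  have hcomp {c : MvPolynomial σ K} {n : ℕ} (hc : c.IsHomogeneous n) (q : MvPolynomial σ K) :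
      homogeneousComponent k (q * c) ∈ gradedPart (Ideal.span {c}) k := by
    refine mem_gradedPart.mpr ⟨?_, homogeneousComponent_isHomogeneous _ _⟩
    rw [mul_comm, homogeneousComponent_mul_of_isHomogeneous hc]
    split_ifs
    · exact Ideal.mul_mem_right _ _ (Ideal.mem_span_singleton_self c)
    · exact zero_mem _
  apply le_antisymm
  · intro x hx
    obtain ⟨hx, hk⟩ := mem_gradedPart.mp hx
    obtain ⟨p, q, rfl⟩ := Ideal.mem_span_pair.mp hx
    rw [← homogeneousComponent_eq_self hk, map_add]
    exact Submodule.add_mem_sup (hcomp ha p) (hcomp hb q)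
  · rw [sup_le_iff]
    exact ⟨inf_le_inf_right _ (Ideal.span_mono (by simp)),
      inf_le_inf_right _ (Ideal.span_mono (by simp))⟩

section Trace

variable {T : MvPolynomial σ K →ₐ[K] MvPolynomial σ K}

theorem mem_gradedPart_span_singleton_of_mem
    (hT : ∀ k (x : MvPolynomial σ K), x.IsHomogeneous k → (T x).IsHomogeneous k)
    {a : MvPolynomial σ K} {c : K} (hTa : T a = c • a) (k : ℕ) :
    ∀ x ∈ gradedPart (Ideal.span {a}) k, T.toLinearMap x ∈ gradedPart (Ideal.span {a}) k := by
  intro x hx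
  obtain ⟨hx, hk⟩ := mem_gradedPart.mp hx
  obtain ⟨q, rfl⟩ := Ideal.mem_span_singleton'.mp hx
  refine mem_gradedPart.mpr ⟨Ideal.mem_span_singleton'.mpr ⟨c • T q, ?_⟩, hT k _ hk⟩
  simp [hTa]

theorem traceOn_gradedPart_span_singleton
    (hT : ∀ k (x : MvPolynomial σ K), x.IsHomogeneous k → (T x).IsHomogeneous k)
    {a : MvPolynomial σ K} {d : ℕ} (ha : a.IsHomogeneous d) (ha0 : a ≠ 0)
    {c : K} (hTa : T a = c • a) :
    PowerSeries.mk (fun k => traceOn T.toLinearMap (gradedPart (Ideal.span {a}) k)) =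
      PowerSeries.C c * PowerSeries.X ^ d *
        PowerSeries.mk fun k => traceOn T.toLinearMap (homogeneousSubmodule σ K k) := by
  ext k
  rw [mul_assoc, PowerSeries.coeff_C_mul, PowerSeries.coeff_X_pow_mul', PowerSeries.coeff_mk]
  split_ifs with h
  · rw [gradedPart_span_singleton_of_le ha h, PowerSeries.coeff_mk]
    refine traceOn_map_of_injective (mul_right_injective₀ ha0) (fun x hx => hT _ x hx) ?_
    intro x _
    simp [hTa]
  · rw [gradedPart_span_singleton_of_lt ha (not_le.mp h), traceOn_bot, mul_zero]

/-- The Koszul computation of the graded trace on a complete intersection of two homogeneous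
eigenvectors. -/
theorem mk_traceOn_sub_traceOn_gradedPart_span_pair [Finite σ]
    (hT : ∀ k (x : MvPolynomial σ K), x.IsHomogeneous k → (T x).IsHomogeneous k)
    {a b : MvPolynomial σ K} {d e : ℕ} (ha : a.IsHomogeneous d) (hb : b.IsHomogeneous e)
    (ha0 : a ≠ 0) (hb0 : b ≠ 0) (hab : IsRelPrime a b)
    {c c' : K} (hTa : T a = c • a) (hTb : T b = c' • b) :
    PowerSeries.mk (fun k => traceOn T.toLinearMap (homogeneousSubmodule σ K k) -
        traceOn T.toLinearMap (gradedPart (Ideal.span {a, b}) k)) =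
      (1 - PowerSeries.C c * PowerSeries.X ^ d) * (1 - PowerSeries.C c' * PowerSeries.X ^ e) *
        PowerSeries.mk fun k => traceOn T.toLinearMap (homogeneousSubmodule σ K k) := by
  have hinf : Ideal.span {a} ⊓ Ideal.span {b} = Ideal.span {a * b} := by
    ext x
    simp only [Submodule.mem_inf, Ideal.mem_span_singleton]
    exact ⟨fun h => hab.mul_dvd h.1 h.2, fun h => ⟨(dvd_mul_right a b).trans h,
      (dvd_mul_left b a).trans h⟩⟩
  have hTab : T (a * b) = (c * c') • (a * b) := by
    rw [map_mul, hTa, hTb, smul_mul_smul_comm]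
  have key (k : ℕ) : traceOn T.toLinearMap (gradedPart (Ideal.span {a, b}) k) =
      traceOn T.toLinearMap (gradedPart (Ideal.span {a}) k) +
      traceOn T.toLinearMap (gradedPart (Ideal.span {b}) k) -
      traceOn T.toLinearMap (gradedPart (Ideal.span {a * b}) k) := by
    rw [gradedPart_span_pair ha hb, ← hinf, ← gradedPart_inf, eq_sub_iff_add_eq]
    exact traceOn_sup_add_traceOn_inf (mem_gradedPart_span_singleton_of_mem hT hTa k)
      (mem_gradedPart_span_singleton_of_mem hT hTb k)
  have h1 := traceOn_gradedPart_span_singleton hT ha ha0 hTa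
  have h2 := traceOn_gradedPart_span_singleton hT hb hb0 hTb
  have h3 := traceOn_gradedPart_span_singleton hT (ha.mul hb) (mul_ne_zero ha0 hb0) hTab
  have hsum : PowerSeries.mk (fun k => traceOn T.toLinearMap (homogeneousSubmodule σ K k) -
        traceOn T.toLinearMap (gradedPart (Ideal.span {a, b}) k)) =
      PowerSeries.mk (fun k => traceOn T.toLinearMap (homogeneousSubmodule σ K k)) -
      PowerSeries.mk (fun k => traceOn T.toLinearMap (gradedPart (Ideal.span {a}) k)) -
      PowerSeries.mk (fun k => traceOn T.toLinearMap (gradedPart (Ideal.span {b}) k)) +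
      PowerSeries.mk (fun k => traceOn T.toLinearMap (gradedPart (Ideal.span {a * b}) k)) := by
    ext k
    simp only [map_add, map_sub, PowerSeries.coeff_mk, key]
    ring
  rw [hsum, h1, h2, h3, map_mul]
  ring

theorem traceOn_homogeneousSubmodule_zero (T : MvPolynomial σ K →ₐ[K] MvPolynomial σ K) :
    traceOn T.toLinearMap (homogeneousSubmodule σ K 0) = 1 := by
  rw [homogeneousSubmodule_zero]
  have hfix : ∀ x ∈ (1 : Submodule K (MvPolynomial σ K)), T.toLinearMap x = x := by
    intro x hx
    obtain ⟨r, rfl⟩ := Submodule.mem_one.mp hx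
    simp
  rw [traceOn_eq fun x hx => by rwa [hfix x hx]]
  have hid : T.toLinearMap.restrict (p := 1) (q := 1) (fun x hx => by rwa [hfix x hx]) =
      LinearMap.id := LinearMap.ext fun x => Subtype.ext (hfix x x.2)
  have : FiniteDimensional K (1 : Submodule K (MvPolynomial σ K)) := by
    rw [Submodule.one_eq_span]
    infer_instance
  rw [hid, LinearMap.trace_id, Submodule.one_eq_span, finrank_span_singleton one_ne_zero,
    Nat.cast_one]

end Trace

theorem isRelPrime_of_X_pow_mem_span_pair {a b : MvPolynomial (Fin 2) K} {n : ℕ}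
    (h : ∀ i, (X i : MvPolynomial (Fin 2) K) ^ n ∈ Ideal.span {a, b}) : IsRelPrime a b := by
  intro d hda hdb
  have hd (i : Fin 2) : d ∣ (X i : MvPolynomial (Fin 2) K) ^ n := by
    obtain ⟨p, q, hpq⟩ := Ideal.mem_span_pair.mp (h i)
    rw [← hpq]
    exact dvd_add (hda.mul_left p) (hdb.mul_left q)
  have hX : IsRelPrime (X 0 : MvPolynomial (Fin 2) K) (X 1) :=
    (X_prime (R := K) (i := (0 : Fin 2))).irreducible.isRelPrime_iff_not_dvd.mpr
      (by simp [X_dvd_X])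
  exact hX.pow (hd 0) (hd 1)

theorem mem_of_isHomogeneous_of_X_pow_mem {I : Ideal (MvPolynomial (Fin 2) K)} {n : ℕ}
    (h : ∀ i, (X i : MvPolynomial (Fin 2) K) ^ n ∈ I) {k : ℕ} (hk : 2 * n - 1 ≤ k)
    {f : MvPolynomial (Fin 2) K} (hf : f.IsHomogeneous k) : f ∈ I := by
  rw [f.as_sum]
  refine Ideal.sum_mem _ fun m hm => ?_
  have hdeg : m 0 + m 1 = k := by
    have h := hf (mem_support_iff.mp hm)
    rwa [show Finsupp.weight (1 : Fin 2 → ℕ) m = m.degree from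
      (DFunLike.congr_fun Finsupp.degree_eq_weight_one m).symm,
      Finsupp.degree_eq_sum, Fin.sum_univ_two] at h
  obtain ⟨i, hi⟩ : ∃ i, n ≤ m i := by
    by_contra! hlt
    have h0 := hlt 0
    have h1 := hlt 1
    lia
  refine Ideal.mem_of_dvd I ?_ (h i)
  rw [X_pow_eq_monomial, monomial_dvd_monomial]
  simp [hi]

end MvPolynomial

/-- A complex 2×2 matrix of finite order has two linearly independent eigenvectors. -/
theorem Matrix.exists_eigenvectors_of_pow_eq_one {B : Matrix (Fin 2) (Fin 2) ℂ} {n : ℕ}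
    (hn : 0 < n) (hB : B ^ n = 1) :
    ∃ (v w : Fin 2 → ℂ) (c c' : ℂ), B *ᵥ v = c • v ∧ B *ᵥ w = c' • w ∧
      v 0 * w 1 - v 1 * w 0 ≠ 0 := by
  set f : Module.End ℂ (Fin 2 → ℂ) := Matrix.toLin' B with hf
  have hpow : Polynomial.aeval f (Polynomial.X ^ n - 1 : Polynomial ℂ) = 0 := by
    rw [map_sub, map_pow, Polynomial.aeval_X, map_one, hf, ← Matrix.toLin'_pow, hB,
      Matrix.toLin'_one, ← Module.End.one_eq_id, sub_self]
  have hsq : Squarefree (Polynomial.X ^ n - 1 : Polynomial ℂ) :=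
    (Polynomial.separable_X_pow_sub_C (1 : ℂ) (by exact_mod_cast hn.ne') one_ne_zero).squarefree
  have htop := (Module.End.isSemisimple_of_squarefree_aeval_eq_zero hsq hpow).iSup_eigenspace_eq_top
  have hexists (P : Submodule ℂ (Fin 2 → ℂ)) (hP : P ≠ ⊤) :
      ∃ (c : ℂ) (v : Fin 2 → ℂ), B *ᵥ v = c • v ∧ v ∉ P := by
    by_contra! h
    refine hP (eq_top_iff.mpr (htop ▸ iSup_le fun c v hv => h c v ?_))
    simpa [hf] using Module.End.mem_eigenspace_iff.mp hv
  obtain ⟨c, v, hv, hv0⟩ := hexists ⊥ bot_ne_top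
  have hspan : Submodule.span ℂ {v} ≠ ⊤ := by
    intro h
    have h1 := finrank_span_singleton (K := ℂ) (v := v) (by simpa using hv0)
    rw [h, finrank_top, Module.finrank_fin_fun] at h1
    norm_num at h1
  obtain ⟨c', w, hw, hwv⟩ := hexists _ hspan
  refine ⟨v, w, c, c', hv, hw, fun hD => hwv ?_⟩
  rw [Submodule.mem_span_singleton]
  by_cases h0 : v 0 = 0
  · have h1 : v 1 ≠ 0 := by
      intro h1
      apply hv0
      rw [Submodule.mem_bot]
      ext i
      fin_cases i <;> assumption
    refine ⟨w 1 / v 1, ?_⟩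
    ext i
    fin_cases i
    · have : w 0 = 0 := by simpa [h0, h1] using hD
      simp [h0, this]
    · simp [h1]
  · refine ⟨w 0 / v 0, ?_⟩
    ext i
    fin_cases i
    · simp [h0]
    · simp only [Fin.mk_one, Pi.smul_apply, smul_eq_mul]
      field_simp
      linear_combination -hD

theorem Matrix.det_one_sub_X_smul_map_C_of_eigenvectors {K : Type*} [Field K]
    {B : Matrix (Fin 2) (Fin 2) K} {v w : Fin 2 → K} {c c' : K}
    (hv : B *ᵥ v = c • v) (hw : B *ᵥ w = c' • w) (hD : v 0 * w 1 - v 1 * w 0 ≠ 0) :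
    Matrix.det ((1 : Matrix (Fin 2) (Fin 2) (Polynomial K)) -
      (Polynomial.X : Polynomial K) • B.map Polynomial.C) =
      (1 - Polynomial.C c * Polynomial.X) * (1 - Polynomial.C c' * Polynomial.X) := by
  have hv0 := congrFun hv 0
  have hv1 := congrFun hv 1
  have hw0 := congrFun hw 0
  have hw1 := congrFun hw 1
  simp only [Matrix.mulVec, dotProduct, Fin.sum_univ_two, Pi.smul_apply, smul_eq_mul]
    at hv0 hv1 hw0 hw1
  have htr : B 0 0 + B 1 1 = c + c' := by
    apply mul_left_cancel₀ hD
    linear_combination w 1 * hv0 - v 1 * hw0 + v 0 * hw1 - w 0 * hv1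
  have hdet : B 0 0 * B 1 1 - B 0 1 * B 1 0 = c * c' := by
    apply mul_left_cancel₀ hD
    linear_combination (B 1 0 * w 0 + B 1 1 * w 1) * hv0 + c * v 0 * hw1 -
      (B 0 0 * w 0 + B 0 1 * w 1) * hv1 - c * v 1 * hw0
  have htr' := congrArg Polynomial.C htr
  have hdet' := congrArg Polynomial.C hdet
  simp only [map_add, map_sub, map_mul] at htr' hdet'
  rw [Matrix.det_fin_two]
  simp only [Matrix.sub_apply, Matrix.one_apply_eq, Matrix.smul_apply, Matrix.map_apply,
    smul_eq_mul, Matrix.one_apply_ne zero_ne_one, Matrix.one_apply_ne one_ne_zero]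
  linear_combination Polynomial.X ^ 2 * hdet' - Polynomial.X * htr'

section Action

variable (g h : Matrix.unitaryGroup (Fin 2) ℂ)

theorem actU2_X (i : Fin 2) :
    actU2 g (X i) = ∑ j : Fin 2,
      C (((g⁻¹ : Matrix.unitaryGroup (Fin 2) ℂ) : Matrix (Fin 2) (Fin 2) ℂ) i j) * X j :=
  aeval_X _ i

theorem actU2_one_s12 : actU2 1 = AlgHom.id ℂ _ := by
  ext1 i
  rw [actU2_X]
  simp [Matrix.one_apply]

theorem actU2_mul_s12 : actU2 (g * h) = (actU2 g).comp (actU2 h) := by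
  ext1 i
  rw [AlgHom.comp_apply, actU2_X, actU2_X, _root_.mul_inv_rev]
  simp only [map_mul, algHom_C, algebraMap_eq, actU2_X, Fin.sum_univ_two, map_add,
    Submonoid.coe_mul, Matrix.mul_apply]
  ring

variable {g} in
theorem isHomogeneous_actU2 {k : ℕ} {f : MvPolynomial (Fin 2) ℂ} (hf : f.IsHomogeneous k) :
    (actU2 g f).IsHomogeneous k := by
  have := hf.aeval (fun i => ∑ j : Fin 2,
      C (((g⁻¹ : Matrix.unitaryGroup (Fin 2) ℂ) : Matrix (Fin 2) (Fin 2) ℂ) i j) * X j)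
    (n := 1) fun i => IsHomogeneous.sum _ _ _ fun j _ => (isHomogeneous_X _ j).C_mul _
  rwa [one_mul] at this

theorem actU2_sum_smul_X (v : Fin 2 → ℂ) :
    actU2 g (∑ i, v i • X i) =
      ∑ i, ((((g⁻¹ : Matrix.unitaryGroup (Fin 2) ℂ) : Matrix (Fin 2) (Fin 2) ℂ)ᵀ) *ᵥ v) i •
        X i := by
  simp only [Fin.sum_univ_two, map_add, map_smul, actU2_X, Matrix.mulVec, dotProduct,
    Matrix.transpose_apply]
  simp only [smul_eq_C_mul, map_add, map_mul]
  ring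

/-- Molien's formula for a single element of finite order. -/
theorem detOneSubT_mul_mk_traceOn (hg : IsOfFinOrder g) :
    (detOneSubT g : PowerSeries ℂ) * PowerSeries.mk (fun k =>
      traceOn (actU2 g).toLinearMap (homogeneousSubmodule (Fin 2) ℂ k)) = 1 := by
  obtain ⟨n, hn, hgn⟩ := isOfFinOrder_iff_pow_eq_one.mp hg
  have hB : (((g⁻¹ : Matrix.unitaryGroup (Fin 2) ℂ) : Matrix (Fin 2) (Fin 2) ℂ)ᵀ) ^ n = 1 := by
    rw [← Matrix.transpose_pow, ← SubmonoidClass.coe_pow, inv_pow, hgn]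
    simp
  obtain ⟨v, w, c, c', hv, hw, hD⟩ := Matrix.exists_eigenvectors_of_pow_eq_one hn hB
  have hlin (u : Fin 2 → ℂ) : (∑ i, u i • X i : MvPolynomial (Fin 2) ℂ).IsHomogeneous 1 :=
    IsHomogeneous.sum _ _ _ fun i _ => by
      rw [smul_eq_C_mul]
      exact (isHomogeneous_X _ i).C_mul _
  have hne {u : Fin 2 → ℂ} (hu : (∑ i, u i • X i : MvPolynomial (Fin 2) ℂ) = 0) : u = 0 := by
    ext i
    have := congrArg (eval (Pi.single i 1)) hu
    fin_cases i <;> simpa [smul_eval, Pi.single_apply] using this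
  have hact {u : Fin 2 → ℂ} {e : ℂ} (hu : (((g⁻¹ : Matrix.unitaryGroup (Fin 2) ℂ) :
      Matrix (Fin 2) (Fin 2) ℂ)ᵀ) *ᵥ u = e • u) :
      actU2 g (∑ i, u i • X i) = e • ∑ i, u i • X i := by
    rw [actU2_sum_smul_X, hu, Finset.smul_sum]
    simp [smul_smul]
  set a : MvPolynomial (Fin 2) ℂ := ∑ i, v i • X i with ha
  set b : MvPolynomial (Fin 2) ℂ := ∑ i, w i • X i with hb
  have ha0 : a ≠ 0 := fun h => hD (by simp [hne h])
  have hb0 : b ≠ 0 := fun h => hD (by simp [hne h])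
  have hDinv : (C (v 0 * w 1 - v 1 * w 0)⁻¹ * C (v 0 * w 1 - v 1 * w 0) :
      MvPolynomial (Fin 2) ℂ) = 1 := by
    rw [← C_mul, inv_mul_cancel₀ hD, C_1]
  have hX : ∀ i, (X i : MvPolynomial (Fin 2) ℂ) ^ 1 ∈ Ideal.span {a, b} := by
    intro i
    rw [pow_one, Ideal.mem_span_pair]
    simp only [ha, hb, Fin.sum_univ_two, smul_eq_C_mul]
    simp only [map_sub, map_mul] at hDinv
    fin_cases i
    · refine ⟨C (v 0 * w 1 - v 1 * w 0)⁻¹ * C (w 1), -(C (v 0 * w 1 - v 1 * w 0)⁻¹ * C (v 1)), ?_⟩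
      simp only [Fin.zero_eta]
      linear_combination X 0 * hDinv
    · refine ⟨-(C (v 0 * w 1 - v 1 * w 0)⁻¹ * C (w 0)), C (v 0 * w 1 - v 1 * w 0)⁻¹ * C (v 0), ?_⟩
      simp only [Fin.mk_one]
      linear_combination X 1 * hDinv
  have hkos := mk_traceOn_sub_traceOn_gradedPart_span_pair (T := actU2 g)
    (fun k x hx => isHomogeneous_actU2 hx) (hlin v) (hlin w) ha0 hb0
    (isRelPrime_of_X_pow_mem_span_pair hX) (hact hv) (hact hw)
  have hone : PowerSeries.mk (fun k =>
      traceOn (actU2 g).toLinearMap (homogeneousSubmodule (Fin 2) ℂ k) -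
        traceOn (actU2 g).toLinearMap (gradedPart (Ideal.span {a, b}) k)) = 1 := by
    ext k
    rw [PowerSeries.coeff_mk, PowerSeries.coeff_one]
    split_ifs with hk
    · subst hk
      rw [gradedPart_span_pair (hlin v) (hlin w), gradedPart_span_singleton_of_lt (hlin v) one_pos,
        gradedPart_span_singleton_of_lt (hlin w) one_pos, sup_bot_eq, traceOn_bot,
        traceOn_homogeneousSubmodule_zero, sub_zero]
    · have : gradedPart (Ideal.span {a, b}) k = homogeneousSubmodule (Fin 2) ℂ k :=
        inf_eq_right.mpr fun x hx => mem_of_isHomogeneous_of_X_pow_mem hX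
          (by lia) ((mem_homogeneousSubmodule _ _).mp hx)
      rw [this, sub_self]
  rw [← hone, hkos, detOneSubT, Matrix.det_one_sub_X_smul_map_C_of_eigenvectors hv hw hD]
  simp

end Action

namespace MvPolynomial

theorem sub_C_eval_zero_mem_span_pair {σ K : Type*} [Field K] {a b f : MvPolynomial σ K}
    (ha : eval 0 a = 0) (hb : eval 0 b = 0)
    (hf : f ∈ Algebra.adjoin K ({a, b} : Set (MvPolynomial σ K))) :
    f - C (eval 0 f) ∈ Ideal.span {a, b} := by
  induction hf using Algebra.adjoin_induction with
  | mem x hx =>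
    have hx0 : eval 0 x = 0 := by
      rcases hx with rfl | rfl <;> assumption
    rw [hx0, C_0, sub_zero]
    exact Ideal.subset_span hx
  | algebraMap r => simp [algebraMap_eq]
  | add x y _ _ hx hy =>
    rw [map_add, C_add, add_sub_add_comm]
    exact add_mem hx hy
  | mul x y _ _ hx hy =>
    rw [map_mul, C_mul, show x * y - C (eval 0 x) * C (eval 0 y) =
      y * (x - C (eval 0 x)) + C (eval 0 x) * (y - C (eval 0 y)) by ring]
    exact add_mem (Ideal.mul_mem_left _ _ hx) (Ideal.mul_mem_left _ _ hy)

theorem pos_of_isHomogeneous_of_transcendental {σ K : Type*} [Field K] {f : MvPolynomial σ K}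
    {d : ℕ} (hf : f.IsHomogeneous d) (ht : Transcendental K f) : 0 < d := by
  rw [Nat.pos_iff_ne_zero]
  rintro rfl
  rw [← mem_homogeneousSubmodule, homogeneousSubmodule_zero] at hf
  obtain ⟨r, rfl⟩ := Submodule.mem_one.mp hf
  exact ht (isAlgebraic_algebraMap r)

theorem IsHomogeneous.eval_zero_eq_zero {σ K : Type*} [Field K] {f : MvPolynomial σ K} {d : ℕ}
    (hf : f.IsHomogeneous d) (hd : 0 < d) : eval 0 f = 0 := by
  rw [eval_zero, constantCoeff_eq]
  exact hf.coeff_eq_zero (by simpa using hd.ne)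

end MvPolynomial

/-- The orbit polynomial of a variable shows that a power of it lies in the ideal generated by
the invariants vanishing at the origin. -/
theorem X_pow_mem_span_invariants (G : Subgroup (Matrix.unitaryGroup (Fin 2) ℂ)) [Finite G]
    (i : Fin 2) :
    (X i : MvPolynomial (Fin 2) ℂ) ^ Nat.card G ∈ Ideal.span
      {f | (∀ g ∈ G, actU2 g f = f) ∧ MvPolynomial.eval (0 : Fin 2 → ℂ) f = 0} := by
  classical
  have := Fintype.ofFinite G
  set I := Ideal.span
      {f | (∀ g ∈ G, actU2 g f = f) ∧ MvPolynomial.eval (0 : Fin 2 → ℂ) f = 0}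
  let p : Polynomial (MvPolynomial (Fin 2) ℂ) :=
    ∏ g : G, (Polynomial.X - Polynomial.C (actU2 (g : Matrix.unitaryGroup (Fin 2) ℂ) (X i)))
  let q := p - Polynomial.X ^ Nat.card G
  have hq_inv (h : G) : q.map (actU2 (h : Matrix.unitaryGroup (Fin 2) ℂ)).toRingHom = q := by
    have hp : p.map (actU2 (h : Matrix.unitaryGroup (Fin 2) ℂ)).toRingHom = p := by
      rw [Polynomial.map_prod]
      refine Fintype.prod_equiv (Equiv.mulLeft h) _ _ fun g => ?_
      rw [Polynomial.map_sub, Polynomial.map_X, Polynomial.map_C, Equiv.coe_mulLeft,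
        Subgroup.coe_mul, actU2_mul_s12]
      rfl
    rw [Polynomial.map_sub, hp, Polynomial.map_pow, Polynomial.map_X]
  have heval (g : Matrix.unitaryGroup (Fin 2) ℂ) : eval (0 : Fin 2 → ℂ) (actU2 g (X i)) = 0 := by
    simp [actU2_X]
  have hq_eval : q.map (eval (0 : Fin 2 → ℂ)) = 0 := by
    rw [Polynomial.map_sub, Polynomial.map_prod, Polynomial.map_pow, Polynomial.map_X]
    simp only [Polynomial.map_sub, Polynomial.map_X, Polynomial.map_C, heval, map_zero, sub_zero]
    rw [Finset.prod_const, Finset.card_univ, ← Nat.card_eq_fintype_card, sub_self]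
  have hcoeff (j : ℕ) : q.coeff j ∈ I := by
    refine Ideal.subset_span ⟨fun h hh => ?_, ?_⟩
    · simpa using congrArg (Polynomial.coeff · j) (hq_inv ⟨h, hh⟩)
    · simpa using congrArg (Polynomial.coeff · j) hq_eval
  have hqX : q.eval (X i) ∈ I := by
    rw [Polynomial.eval_eq_sum]
    exact Ideal.sum_mem _ fun j _ => Ideal.mul_mem_right _ _ (hcoeff j)
  have hp : p.eval (X i) = 0 := by
    rw [Polynomial.eval_prod]
    exact Finset.prod_eq_zero (Finset.mem_univ 1) (by simp [actU2_one_s12])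
  simpa [q, hp] using hqX

/-- Let `G` be a finite subgroup of U(2) generated by reflections whose invariant ring
is `ℂ[f₁, f₂]` with `f₁, f₂` algebraically independent homogeneous of degrees `d₁, d₂`.
Let `F_k` be the graded pieces of the coinvariant algebra `F = S/S𝔪₀`, with the induced
action `τ` of `G`.  Then for every `g ∈ G`,
`det(I − t·ρ(g)) · Σ_k tr(g|F_k) tᵏ = (1 − t^{d₁})(1 − t^{d₂})` in `ℂ[t]`
(the sum is finite: `F_k = 0` for all large `k`). -/
theorem poincare_series_of_coinvariants
    (G : Subgroup (Matrix.unitaryGroup (Fin 2) ℂ)) (hGfin : Finite G)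
    (hrefl : G = Subgroup.closure {g | g ∈ G ∧ IsReflectionU2 g})
    (f₁ f₂ : MvPolynomial (Fin 2) ℂ) (d₁ d₂ : ℕ)
    (hf₁ : f₁.IsHomogeneous d₁) (hf₂ : f₂.IsHomogeneous d₂)
    (hind : AlgebraicIndependent ℂ ![f₁, f₂])
    (hR : ∀ f : MvPolynomial (Fin 2) ℂ,
      (∀ g ∈ G, actU2 g f = f) ↔ f ∈ Algebra.adjoin ℂ ({f₁, f₂} : Set (MvPolynomial (Fin 2) ℂ)))
    (J : Ideal (MvPolynomial (Fin 2) ℂ))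
    (hJ : J = Ideal.span {f | (∀ g ∈ G, actU2 g f = f) ∧
      MvPolynomial.eval (0 : Fin 2 → ℂ) f = 0})
    (τ : (g : G) → (k : ℕ) → gradedPiece J k →ₗ[ℂ] gradedPiece J k)
    (hτ : ∀ (g : G) (k : ℕ) (f : MvPolynomial (Fin 2) ℂ)
      (hf : f ∈ MvPolynomial.homogeneousSubmodule (Fin 2) ℂ k),
      (τ g k ⟨Ideal.Quotient.mk J f, Submodule.mem_map_of_mem hf⟩ :
          MvPolynomial (Fin 2) ℂ ⧸ J) =
        Ideal.Quotient.mk J (actU2 (g : Matrix.unitaryGroup (Fin 2) ℂ) f)) :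
    (∃ N : ℕ, ∀ k ≥ N, gradedPiece J k = ⊥) ∧
    ∀ (g : G) (N : ℕ), (∀ k ≥ N, gradedPiece J k = ⊥) →
      detOneSubT (g : Matrix.unitaryGroup (Fin 2) ℂ) *
          ∑ k ∈ Finset.range N,
            Polynomial.C (LinearMap.trace ℂ (gradedPiece J k) (τ g k)) * Polynomial.X ^ k =
        (1 - Polynomial.X ^ d₁) * (1 - Polynomial.X ^ d₂) := by
  have ht₁ : Transcendental ℂ f₁ := hind.transcendental 0
  have ht₂ : Transcendental ℂ f₂ := hind.transcendental 1
  have h0₁ := hf₁.eval_zero_eq_zero (pos_of_isHomogeneous_of_transcendental hf₁ ht₁)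
  have h0₂ := hf₂.eval_zero_eq_zero (pos_of_isHomogeneous_of_transcendental hf₂ ht₂)
  have hinv₁ := (hR f₁).mpr (Algebra.subset_adjoin (by simp))
  have hinv₂ := (hR f₂).mpr (Algebra.subset_adjoin (by simp))
  have hJX : ∀ i, (X i : MvPolynomial (Fin 2) ℂ) ^ Nat.card G ∈ J :=
    hJ ▸ X_pow_mem_span_invariants G
  have hJspan : J = Ideal.span {f₁, f₂} := by
    rw [hJ]
    apply le_antisymm
    · refine Ideal.span_le.mpr fun f hf => ?_
      have h := sub_C_eval_zero_mem_span_pair h0₁ h0₂ ((hR f).mp hf.1)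
      rwa [hf.2, C_0, sub_zero] at h
    · refine Ideal.span_mono ?_
      rintro f (rfl | rfl)
      · exact ⟨hinv₁, h0₁⟩
      · exact ⟨hinv₂, h0₂⟩
  refine ⟨⟨2 * Nat.card G - 1, fun k hk => ?_⟩, fun g N hN => ?_⟩
  · rw [gradedPiece, ← LinearMap.le_ker_iff_map]
    intro f hf
    exact Ideal.Quotient.eq_zero_iff_mem.mpr (mem_of_isHomogeneous_of_X_pow_mem hJX hk hf)
  set T := actU2 (g : Matrix.unitaryGroup (Fin 2) ℂ) with hTdef
  have hT : ∀ k (x : MvPolynomial (Fin 2) ℂ), x.IsHomogeneous k → (T x).IsHomogeneous k :=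
    fun k x hx => isHomogeneous_actU2 hx
  have hTJ : J ≤ J.comap T := by
    rw [hJspan, Ideal.span_le]
    rintro f (rfl | rfl)
    · exact Ideal.subset_span (by simp [hTdef, hinv₁ g g.2])
    · exact Ideal.subset_span (by simp [hTdef, hinv₂ g g.2])
  have htrace (k : ℕ) : LinearMap.trace ℂ (gradedPiece J k) (τ g k) =
      traceOn T.toLinearMap (homogeneousSubmodule (Fin 2) ℂ k) -
        traceOn T.toLinearMap (gradedPart J k) := by
    rw [eq_sub_iff_add_eq, eq_comm, add_comm]
    refine traceOn_eq_add_trace_of_surjective (P := homogeneousSubmodule (Fin 2) ℂ k)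
      (Q := gradedPart J k)
      (fun x hx => hT k x hx) (fun x hx => ⟨hTJ hx.1, hT k x hx.2⟩) inf_le_right
      (φ := (Ideal.Quotient.mkₐ ℂ J).toLinearMap.submoduleMap _)
      (LinearMap.submoduleMap_surjective _ _) (fun x => ?_) (fun x => Subtype.ext (hτ g k x x.2))
    rw [← Subtype.coe_inj]
    exact Ideal.Quotient.eq_zero_iff_mem.trans ⟨fun h => ⟨h, x.2⟩, fun h => h.1⟩
  have hkos := mk_traceOn_sub_traceOn_gradedPart_span_pair hT hf₁ hf₂ (hind.ne_zero 0) (hind.ne_zero 1)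
    (isRelPrime_of_X_pow_mem_span_pair (hJspan ▸ hJX))
    (c := 1) (c' := 1) (by rw [one_smul, hinv₁ g g.2]) (by rw [one_smul, hinv₂ g g.2])
  have hsum : ((∑ k ∈ Finset.range N, Polynomial.C (LinearMap.trace ℂ (gradedPiece J k) (τ g k)) *
      Polynomial.X ^ k : Polynomial ℂ) : PowerSeries ℂ) =
      PowerSeries.mk fun k => LinearMap.trace ℂ (gradedPiece J k) (τ g k) := by
    ext k
    rw [Polynomial.coeff_coe, PowerSeries.coeff_mk, Polynomial.finsetSum_coeff]
    simp only [Polynomial.coeff_C_mul_X_pow, Finset.sum_ite_eq, Finset.mem_range]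
    split_ifs with hk
    · rfl
    · have : Subsingleton (gradedPiece J k) := by
        rw [hN k (not_lt.mp hk)]
        infer_instance
      rw [Subsingleton.elim (τ g k) 0, map_zero]
  apply Polynomial.coe_injective
  have hmolien := detOneSubT_mul_mk_traceOn (g : Matrix.unitaryGroup (Fin 2) ℂ)
    (G.subtype.isOfFinOrder (isOfFinOrder_of_finite g))
  rw [Polynomial.coe_mul, hsum]
  simp only [htrace]
  rw [← hJspan] at hkos
  rw [hkos, mul_left_comm, hmolien]
  simp
end
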